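/- arXiv:1304.5958 — 2 statements merged into one kernel-verified Lean document; each statement's English description precedes it below -/
import Mathlib

section
/- Let s > -1 and r, t > 0 satisfy t < s + 2 < r. Then there exists a constant C > 0, depending only on s, r, t, such that for all z, ζ in the open unit disc 𝔻, ∫_𝔻 (1−|η|²)^s / (|1−η̄z|^r |1−η̄ζ|^t) dA(η) ≤ C / ((1−|z|²)^{r−s−2} |1−ζ̄z|^t). -/
open MeasureTheory

noncomputable section

open Set

namespace BergmanDisc

theorem norm_one_sub_direction_le {v u : ℂ} (hv : ‖v‖ ≤ 1) (hu : ‖u‖ = 1) {ρ : ℝ}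
    (h0 : 0 ≤ ρ) (h1 : ρ ≤ 1) : ‖1 - v * u‖ ≤ 2 * ‖1 - v * (ρ * u)‖ := by
  have h2 : ‖v * (ρ * u)‖ ≤ ρ := by
    rw [norm_mul, norm_mul, hu, Complex.norm_of_nonneg h0]
    nlinarith [norm_nonneg v]
  have h3 : 1 - ρ ≤ ‖1 - v * (ρ * u)‖ := by
    have := norm_sub_norm_le (1 : ℂ) (v * (ρ * u))
    rw [norm_one] at this
    linarith
  have h4 : ‖v * u * (1 - ρ : ℝ)‖ ≤ 1 - ρ := by
    rw [norm_mul, norm_mul, hu, Complex.norm_of_nonneg (by linarith)]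
    nlinarith [norm_nonneg v]
  have h5 : 1 - v * u = (1 - v * (ρ * u)) - v * u * (1 - ρ : ℝ) := by push_cast; ring
  calc ‖1 - v * u‖ ≤ ‖1 - v * (ρ * u)‖ + ‖v * u * (1 - ρ : ℝ)‖ := by
        rw [h5]; exact norm_sub_le _ _
    _ ≤ _ := by linarith

theorem abs_div_pi_le_norm_one_sub_exp {θ : ℝ} (hθ : |θ| ≤ Real.pi) :
    2 * (|θ| / Real.pi) ≤ ‖1 - Complex.exp (θ * Complex.I)‖ := by
  have h := Real.mul_abs_le_abs_sin (x := θ / 2) (by rw [abs_div, abs_two]; linarith)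
  rw [norm_sub_rev, mul_comm (θ : ℂ), Complex.norm_exp_I_mul_ofReal_sub_one, norm_mul,
    Real.norm_eq_abs, Real.norm_eq_abs, abs_two]
  rw [abs_div, abs_two] at h
  calc 2 * (|θ| / Real.pi) = 2 * (2 / Real.pi * (|θ| / 2)) := by ring
    _ ≤ _ := by linarith

theorem abs_div_pi_le_norm_one_sub {ρ θ : ℝ} (h0 : 0 ≤ ρ) (h1 : ρ ≤ 1) (hθ : |θ| ≤ Real.pi) :
    |θ| / Real.pi ≤ ‖1 - ρ * Complex.exp (θ * Complex.I)‖ := by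
  have h2 := norm_one_sub_direction_le (v := 1) (u := Complex.exp (θ * Complex.I)) (by simp)
    (Complex.norm_exp_ofReal_mul_I θ) h0 h1
  have h3 := abs_div_pi_le_norm_one_sub_exp hθ
  simp only [one_mul] at h2
  linarith

theorem lintegral_one_sub_rpow_lt_top {a : ℝ} (ha : -1 < a) :
    ∫⁻ ρ in Ioo (0:ℝ) 1, ENNReal.ofReal ((1 - ρ) ^ a) < ⊤ := by
  have h : IntegrableOn (fun x : ℝ => (1 - x) ^ a) (Ioo 0 1) := by
    have := ((intervalIntegral.intervalIntegrable_rpow' (a := 0) (b := 1) ha).comp_sub_left 1).symm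
    simp only [sub_self, sub_zero] at this
    exact ((intervalIntegrable_iff_integrableOn_Ioo_of_le zero_le_one).1 this)
  exact h.lintegral_lt_top

theorem lintegral_abs_div_pi_rpow_lt_top {b : ℝ} (hb : -1 < b) :
    ∫⁻ θ in Ioo (-Real.pi) Real.pi, ENNReal.ofReal ((|θ| / Real.pi) ^ b) < ⊤ := by
  have hpi := Real.pi_pos
  have h0 : IntervalIntegrable (fun x : ℝ => |x| ^ b) volume 0 Real.pi := by
    refine (intervalIntegral.intervalIntegrable_rpow' (a := 0) (b := Real.pi) hb).congr ?_
    intro x hx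
    rw [uIoc_of_le hpi.le] at hx
    simp [abs_of_pos hx.1]
  have h1 : IntervalIntegrable (fun x : ℝ => |x| ^ b) volume (-Real.pi) 0 := by
    have := ((IntervalIntegrable.iff_comp_neg).1 h0).symm
    simpa using this
  have h : IntegrableOn (fun x : ℝ => (|x| / Real.pi) ^ b) (Ioo (-Real.pi) Real.pi) := by
    have h2 := ((intervalIntegrable_iff_integrableOn_Ioo_of_le (by linarith)).1
      (h1.trans h0)).mul_const ((Real.pi ^ b)⁻¹)
    refine IntegrableOn.congr_fun h2 (fun x _ => ?_) measurableSet_Ioo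
    rw [Real.div_rpow (abs_nonneg x) hpi.le, div_eq_mul_inv]
  exact h.lintegral_lt_top

/-- The weight `(1 - |w|²)^s |1 - w|^{-c}` in polar coordinates is dominated by a product. -/
theorem weight_polar_le {s c ρ θ : ℝ} (hs : -1 < s) (hc : 0 < c)
    (h0 : 0 < ρ) (h1 : ρ < 1) (hθ : |θ| ≤ Real.pi) (hθ0 : θ ≠ 0) :
    ρ * ((1 - ρ ^ 2) ^ s * ‖1 - ρ * Complex.exp (θ * Complex.I)‖ ^ (-c)) ≤
      2 ^ |s| * (1 - ρ) ^ (s - c * (s + 1) / (s + 2)) * (|θ| / Real.pi) ^ (-(c / (s + 2))) := by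
  set N := ‖1 - ρ * Complex.exp (θ * Complex.I)‖ with hN
  have hN1 : 1 - ρ ≤ N := by
    have := norm_sub_norm_le (1 : ℂ) (ρ * Complex.exp (θ * Complex.I))
    rw [norm_one, norm_mul, Complex.norm_exp_ofReal_mul_I, Complex.norm_of_nonneg h0.le] at this
    linarith
  have hN2 : |θ| / Real.pi ≤ N := abs_div_pi_le_norm_one_sub h0.le h1.le hθ
  have hρ : 0 < 1 - ρ := by linarith
  have hNpos : 0 < N := by linarith
  have hθpos : 0 < |θ| / Real.pi := div_pos (abs_pos.2 hθ0) Real.pi_pos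
  have hs2 : 0 < s + 2 := by linarith
  have e1 : N ^ (-c) = N ^ (-(c * (s + 1) / (s + 2))) * N ^ (-(c / (s + 2))) := by
    rw [← Real.rpow_add hNpos]; congr 1; field_simp; ring
  have e2 : N ^ (-(c * (s + 1) / (s + 2))) ≤ (1 - ρ) ^ (-(c * (s + 1) / (s + 2))) := by
    refine Real.rpow_le_rpow_of_nonpos hρ hN1 ?_
    have : 0 ≤ c * (s + 1) / (s + 2) := div_nonneg (mul_nonneg hc.le (by linarith)) hs2.le
    linarith
  have e3 : N ^ (-(c / (s + 2))) ≤ (|θ| / Real.pi) ^ (-(c / (s + 2))) := by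
    refine Real.rpow_le_rpow_of_nonpos hθpos hN2 ?_
    have : 0 ≤ c / (s + 2) := div_nonneg hc.le hs2.le
    linarith
  have e4 : (1 - ρ ^ 2) ^ s ≤ 2 ^ |s| * (1 - ρ) ^ s := by
    rw [show 1 - ρ ^ 2 = (1 + ρ) * (1 - ρ) by ring, Real.mul_rpow (by linarith) hρ.le]
    gcongr
    calc (1 + ρ) ^ s ≤ (1 + ρ) ^ |s| :=
          Real.rpow_le_rpow_of_exponent_le (by linarith) (le_abs_self s)
      _ ≤ 2 ^ |s| := Real.rpow_le_rpow (by linarith) (by linarith) (abs_nonneg s)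
  have e5 : (0:ℝ) ≤ (1 - ρ ^ 2) ^ s := Real.rpow_nonneg (by nlinarith) _
  calc ρ * ((1 - ρ ^ 2) ^ s * N ^ (-c)) ≤ 1 * ((1 - ρ ^ 2) ^ s * N ^ (-c)) := by gcongr
    _ ≤ 1 * ((2 ^ |s| * (1 - ρ) ^ s) * ((1 - ρ) ^ (-(c * (s + 1) / (s + 2))) *
          (|θ| / Real.pi) ^ (-(c / (s + 2))))) := by rw [e1]; gcongr
    _ = _ := by rw [sub_eq_add_neg s, Real.rpow_add hρ]; ring

theorem lintegral_weight_one_lt_top {s c : ℝ} (hs : -1 < s) (hc : 0 < c) (hcs : c < s + 2) :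
    ∫⁻ w in Metric.ball (0:ℂ) 1, ENNReal.ofReal ((1 - ‖w‖ ^ 2) ^ s * ‖1 - w‖ ^ (-c)) < ⊤ := by
  have hs2 : 0 < s + 2 := by linarith
  rw [← lintegral_indicator Metric.isOpen_ball.measurableSet, ← Complex.lintegral_comp_polarCoord_symm]
  let g : ℝ → ENNReal := (Ioo (0:ℝ) 1).indicator
    fun ρ => ENNReal.ofReal ((1 - ρ) ^ (s - c * (s + 1) / (s + 2)))
  let h : ℝ → ENNReal := (Ioo (-Real.pi) Real.pi).indicator
    fun θ => ENNReal.ofReal ((|θ| / Real.pi) ^ (-(c / (s + 2))))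
  have hg : Measurable g := by
    refine Measurable.indicator ?_ measurableSet_Ioo
    fun_prop
  have hh : Measurable h := by
    refine Measurable.indicator ?_ measurableSet_Ioo
    fun_prop
  have hne : ∀ᵐ p : ℝ × ℝ, p.2 ≠ 0 :=
    Measure.quasiMeasurePreserving_snd.ae (p := fun x : ℝ => x ≠ 0) (Measure.ae_ne volume 0)
  calc _ ≤ ∫⁻ p : ℝ × ℝ in polarCoord.target, ENNReal.ofReal (2 ^ |s|) * (g p.1 * h p.2) := by
        refine setLIntegral_mono_ae (by fun_prop) ?_
        filter_upwards [hne] with p hp2 hp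
        obtain ⟨ρ, θ⟩ := p
        obtain ⟨hρ, hθ⟩ : 0 < ρ ∧ θ ∈ Ioo (-Real.pi) Real.pi := by simpa [polarCoord] using hp
        have hsymm : Complex.polarCoord.symm (ρ, θ) = ρ * Complex.exp (θ * Complex.I) := by
          rw [Complex.polarCoord_symm_apply, Complex.exp_mul_I]; simp
        have hnorm : ‖Complex.polarCoord.symm (ρ, θ)‖ = ρ := by
          rw [hsymm, norm_mul, Complex.norm_exp_ofReal_mul_I, Complex.norm_of_nonneg hρ.le, mul_one]
        by_cases hρ1 : ρ < 1
        · have hg' : g ρ = ENNReal.ofReal ((1 - ρ) ^ (s - c * (s + 1) / (s + 2))) :=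
            indicator_of_mem (show ρ ∈ Ioo (0:ℝ) 1 from ⟨hρ, hρ1⟩) _
          have hh' : h θ = ENNReal.ofReal ((|θ| / Real.pi) ^ (-(c / (s + 2)))) :=
            indicator_of_mem hθ _
          rw [indicator_of_mem (mem_ball_zero_iff.2 (hnorm.trans_lt hρ1)), hnorm, hsymm, smul_eq_mul, hg', hh',
            ← ENNReal.ofReal_mul hρ.le, ← mul_assoc (ENNReal.ofReal (2 ^ |s|)),
            ← ENNReal.ofReal_mul (by positivity),
            ← ENNReal.ofReal_mul (mul_nonneg (by positivity) (Real.rpow_nonneg (by linarith) _))]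
          exact ENNReal.ofReal_le_ofReal
            (weight_polar_le hs hc hρ hρ1 (abs_le.2 ⟨hθ.1.le, hθ.2.le⟩) hp2)
        · rw [indicator_of_notMem (by rwa [mem_ball_zero_iff, hnorm])]
          simp
    _ ≤ ∫⁻ p : ℝ × ℝ, ENNReal.ofReal (2 ^ |s|) * (g p.1 * h p.2) := setLIntegral_le_lintegral _ _
    _ = ENNReal.ofReal (2 ^ |s|) * ((∫⁻ x, g x) * ∫⁻ y, h y) := by
        rw [lintegral_const_mul _ (by fun_prop), Measure.volume_eq_prod,
          lintegral_prod_mul hg.aemeasurable hh.aemeasurable]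
    _ < ⊤ := by
        refine ENNReal.mul_lt_top ENNReal.ofReal_lt_top (ENNReal.mul_lt_top ?_ ?_)
        · rw [lintegral_indicator measurableSet_Ioo]
          refine lintegral_one_sub_rpow_lt_top ?_
          have : c * (s + 1) / (s + 2) < s + 1 := by
            rw [div_lt_iff₀ hs2]; nlinarith
          linarith
        · rw [lintegral_indicator measurableSet_Ioo]
          refine lintegral_abs_div_pi_rpow_lt_top ?_
          have : c / (s + 2) < 1 := by rwa [div_lt_one hs2]
          linarith

/-- Uniform Forelli–Rudin estimate in the subcritical range. -/
theorem exists_lintegral_weight_le {s c : ℝ} (hs : -1 < s) (hc : 0 < c) (hcs : c < s + 2) :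
    ∃ M : ENNReal, M < ⊤ ∧ ∀ ξ ∈ Metric.ball (0:ℂ) 1,
      ∫⁻ w in Metric.ball (0:ℂ) 1,
        ENNReal.ofReal ((1 - ‖w‖ ^ 2) ^ s * ‖1 - (starRingEnd ℂ) w * ξ‖ ^ (-c)) ≤ M := by
  refine ⟨ENNReal.ofReal (2 ^ c) * ∫⁻ w in Metric.ball (0:ℂ) 1,
    ENNReal.ofReal ((1 - ‖w‖ ^ 2) ^ s * ‖1 - w‖ ^ (-c)),
    ENNReal.mul_lt_top ENNReal.ofReal_lt_top (lintegral_weight_one_lt_top hs hc hcs), ?_⟩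
  intro ξ hξ
  have hξ1 : ‖ξ‖ < 1 := by simpa using hξ
  let u : Circle := Circle.exp (Complex.arg ξ)
  have hu : ‖(u : ℂ)‖ = 1 := Circle.norm_coe u
  have hξu : ξ = ‖ξ‖ * (u : ℂ) := by
    simp [u, Circle.coe_exp, Complex.norm_mul_exp_arg_mul_I]
  have hmp : MeasurePreserving (rotation u⁻¹) (volume : Measure ℂ) volume :=
    (rotation u⁻¹).measurePreserving
  have hpre : (rotation u⁻¹) ⁻¹' Metric.ball (0:ℂ) 1 = Metric.ball (0:ℂ) 1 := by
    ext w; simp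
  have hrot := hmp.setLIntegral_comp_preimage_emb
    (rotation u⁻¹).toHomeomorph.measurableEmbedding
    (fun w => ENNReal.ofReal ((1 - ‖w‖ ^ 2) ^ s * ‖1 - w‖ ^ (-c))) (Metric.ball (0:ℂ) 1)
  rw [hpre] at hrot
  rw [← hrot, ← lintegral_const_mul _ (by fun_prop)]
  refine setLIntegral_mono (by fun_prop) fun w hw => ?_
  have hw1 : ‖w‖ < 1 := by simpa using hw
  have hconj : ‖1 - rotation u⁻¹ w‖ = ‖1 - (starRingEnd ℂ) w * u‖ := by
    rw [← Complex.norm_conj, rotation_apply, map_sub, map_one, map_mul, Circle.coe_inv_eq_conj,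
      Complex.conj_conj, mul_comm]
  have hle : ‖1 - (starRingEnd ℂ) w * u‖ ≤ 2 * ‖1 - (starRingEnd ℂ) w * ξ‖ := by
    have := norm_one_sub_direction_le (v := (starRingEnd ℂ) w) (u := u)
      (by simpa using hw1.le) hu (norm_nonneg ξ) hξ1.le
    rwa [← hξu] at this
  have hpos : 0 < ‖1 - (starRingEnd ℂ) w * u‖ := by
    have := norm_sub_norm_le (1 : ℂ) ((starRingEnd ℂ) w * u)
    rw [norm_one, norm_mul, hu, Complex.norm_conj] at this
    linarith
  rw [hconj, LinearIsometryEquiv.norm_map, ← ENNReal.ofReal_mul (by positivity)]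
  refine ENNReal.ofReal_le_ofReal ?_
  have hB : 0 < ‖1 - (starRingEnd ℂ) w * ξ‖ := by linarith
  have hW : (0:ℝ) ≤ (1 - ‖w‖ ^ 2) ^ s := Real.rpow_nonneg (by nlinarith [norm_nonneg w]) _
  have key : ‖1 - (starRingEnd ℂ) w * ξ‖ ^ (-c) ≤ 2 ^ c * ‖1 - (starRingEnd ℂ) w * u‖ ^ (-c) := by
    calc ‖1 - (starRingEnd ℂ) w * ξ‖ ^ (-c)
        = 2 ^ c * (2 * ‖1 - (starRingEnd ℂ) w * ξ‖) ^ (-c) := by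
          rw [Real.mul_rpow (by norm_num) hB.le, ← mul_assoc, ← Real.rpow_add (by norm_num)]
          simp
      _ ≤ _ := by
          gcongr 2 ^ c * ?_
          exact Real.rpow_le_rpow_of_nonpos hpos hle (by linarith)
  calc _ ≤ (1 - ‖w‖ ^ 2) ^ s * (2 ^ c * ‖1 - (starRingEnd ℂ) w * u‖ ^ (-c)) := by gcongr
    _ = _ := by ring

/-- The involutive automorphism of the unit disc that exchanges `0` and `z`. -/
def moebius (z w : ℂ) : ℂ := (z - w) / (1 - (starRingEnd ℂ) z * w)

theorem norm_conj_mul_lt_one {z w : ℂ} (hz : ‖z‖ < 1) (hw : ‖w‖ < 1) :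
    ‖(starRingEnd ℂ) z * w‖ < 1 := by
  rw [norm_mul, Complex.norm_conj]
  nlinarith [norm_nonneg z, norm_nonneg w]

theorem one_sub_conj_mul_ne_zero {z w : ℂ} (hz : ‖z‖ < 1) (hw : ‖w‖ < 1) :
    1 - (starRingEnd ℂ) z * w ≠ 0 := by
  intro h
  have := norm_conj_mul_lt_one hz hw
  rw [← sub_eq_zero.1 h, norm_one] at this
  exact lt_irrefl _ this

theorem norm_one_sub_conj_mul_comm (z w : ℂ) :
    ‖1 - (starRingEnd ℂ) z * w‖ = ‖1 - (starRingEnd ℂ) w * z‖ := by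
  rw [← Complex.norm_conj]
  simp [mul_comm]

theorem one_sub_sq_norm_moebius {z w : ℂ} (hz : ‖z‖ < 1) (hw : ‖w‖ < 1) :
    1 - ‖moebius z w‖ ^ 2 =
      (1 - ‖z‖ ^ 2) * (1 - ‖w‖ ^ 2) / ‖1 - (starRingEnd ℂ) z * w‖ ^ 2 := by
  have h := norm_ne_zero_iff.2 (one_sub_conj_mul_ne_zero hz hw)
  rw [moebius, norm_div, div_pow, eq_div_iff (pow_ne_zero 2 h), sub_mul,
    div_mul_cancel₀ _ (pow_ne_zero 2 h)]
  simp only [← Complex.normSq_eq_norm_sq, Complex.normSq_apply]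
  simp
  ring

theorem norm_moebius_lt_one {z w : ℂ} (hz : ‖z‖ < 1) (hw : ‖w‖ < 1) : ‖moebius z w‖ < 1 := by
  have h := norm_pos_iff.2 (one_sub_conj_mul_ne_zero hz hw)
  have h1 : 0 < 1 - ‖z‖ ^ 2 := by nlinarith [norm_nonneg z]
  have h2 : 0 < 1 - ‖w‖ ^ 2 := by nlinarith [norm_nonneg w]
  have h3 : 0 < 1 - ‖moebius z w‖ ^ 2 := by
    rw [one_sub_sq_norm_moebius hz hw]; positivity
  nlinarith [norm_nonneg (moebius z w)]

theorem one_sub_conj_mul_self (z : ℂ) : 1 - (starRingEnd ℂ) z * z = (1 - ‖z‖ ^ 2 : ℝ) := by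
  rw [Complex.conj_mul']; push_cast; ring

theorem moebius_moebius {z w : ℂ} (hz : ‖z‖ < 1) (hw : ‖w‖ < 1) :
    moebius z (moebius z w) = w := by
  have h := one_sub_conj_mul_ne_zero hz hw
  have h1 := one_sub_conj_mul_ne_zero hz (norm_moebius_lt_one hz hw)
  have h2 : moebius z w * (1 - (starRingEnd ℂ) z * w) = z - w := div_mul_cancel₀ _ h
  rw [moebius, div_eq_iff h1]
  linear_combination -h2

theorem image_moebius_ball {z : ℂ} (hz : ‖z‖ < 1) :
    moebius z '' Metric.ball (0:ℂ) 1 = Metric.ball (0:ℂ) 1 := by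
  ext w
  simp only [mem_image, mem_ball_zero_iff]
  constructor
  · rintro ⟨v, hv, rfl⟩
    exact norm_moebius_lt_one hz hv
  · exact fun hw => ⟨moebius z w, norm_moebius_lt_one hz hw, moebius_moebius hz hw⟩

theorem injOn_moebius_ball {z : ℂ} (hz : ‖z‖ < 1) : InjOn (moebius z) (Metric.ball (0:ℂ) 1) := by
  intro v hv w hw h
  rw [mem_ball_zero_iff] at hv hw
  rw [← moebius_moebius hz hv, h, moebius_moebius hz hw]

theorem hasDerivAt_moebius {z w : ℂ} (hz : ‖z‖ < 1) (hw : ‖w‖ < 1) :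
    HasDerivAt (moebius z) (-(1 - ‖z‖ ^ 2 : ℝ) / (1 - (starRingEnd ℂ) z * w) ^ 2) w := by
  have h := one_sub_conj_mul_ne_zero hz hw
  have h1 : HasDerivAt (fun w : ℂ => z - w) (-1) w := by
    simpa using (hasDerivAt_id w).const_sub z
  have h2 : HasDerivAt (fun w : ℂ => 1 - (starRingEnd ℂ) z * w) (-(starRingEnd ℂ) z) w := by
    simpa using ((hasDerivAt_id w).const_mul ((starRingEnd ℂ) z)).const_sub 1
  refine (h1.div h2 h).congr_deriv ?_
  rw [← one_sub_conj_mul_self]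
  ring

/-- Change of variables for an injective holomorphic map. -/
theorem lintegral_image_eq_lintegral_norm_deriv_sq_mul {S : Set ℂ} (hS : MeasurableSet S)
    {f f' : ℂ → ℂ} (hf' : ∀ w ∈ S, HasDerivAt f (f' w) w) (hf : InjOn f S) (g : ℂ → ENNReal) :
    ∫⁻ η in f '' S, g η = ∫⁻ w in S, ENNReal.ofReal (‖f' w‖ ^ 2) * g (f w) := by
  rw [lintegral_image_eq_lintegral_abs_det_fderiv_mul volume hS
    (fun w hw => ((hf' w hw).hasFDerivAt.restrictScalars ℝ).hasFDerivWithinAt) hf]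
  refine setLIntegral_congr_fun hS fun w _ => ?_
  have : ((ContinuousLinearMap.toSpanSingleton ℂ (f' w)).restrictScalars ℝ).det = ‖f' w‖ ^ 2 := by
    rw [← Complex.normSq_eq_norm_sq, ← Algebra.norm_complex_apply, Algebra.norm_apply,
      ContinuousLinearMap.det]
    congr 1
    ext; simp [mul_comm]
  simp only [this, abs_of_nonneg (sq_nonneg ‖f' w‖)]

theorem norm_one_sub_conj_moebius_mul {z w ζ : ℂ} (hz : ‖z‖ < 1) (hw : ‖w‖ < 1) (hζ : ‖ζ‖ < 1) :
    ‖1 - (starRingEnd ℂ) (moebius z w) * ζ‖ =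
      ‖1 - (starRingEnd ℂ) ζ * z‖ * ‖1 - (starRingEnd ℂ) w * moebius z ζ‖ /
        ‖1 - (starRingEnd ℂ) w * z‖ := by
  have h := one_sub_conj_mul_ne_zero hw hz
  have h' := one_sub_conj_mul_ne_zero hz hζ
  rw [norm_one_sub_conj_mul_comm ζ z, ← norm_mul, ← norm_div]
  congr 1
  rw [moebius, moebius, map_div₀, map_sub, map_sub, map_one, map_mul, Complex.conj_conj]
  rw [mul_comm z]
  field_simp
  ring

theorem norm_one_sub_conj_moebius_mul_self {z w : ℂ} (hz : ‖z‖ < 1) (hw : ‖w‖ < 1) :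
    ‖1 - (starRingEnd ℂ) (moebius z w) * z‖ = (1 - ‖z‖ ^ 2) / ‖1 - (starRingEnd ℂ) w * z‖ := by
  have h0 : (0:ℝ) ≤ 1 - ‖z‖ ^ 2 := by nlinarith [norm_nonneg z]
  rw [norm_one_sub_conj_moebius_mul hz hw hz, one_sub_conj_mul_self, Complex.norm_of_nonneg h0]
  simp [moebius]

/-- The integrand after the change of variables `η = moebius z w`. -/
theorem jacobian_mul_integrand_moebius {s r t : ℝ} {z w ζ : ℂ} (hz : ‖z‖ < 1) (hw : ‖w‖ < 1)
    (hζ : ‖ζ‖ < 1) :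
    ‖-((1 - ‖z‖ ^ 2 : ℝ) : ℂ) / (1 - (starRingEnd ℂ) z * w) ^ 2‖ ^ 2 *
      ((1 - ‖moebius z w‖ ^ 2) ^ s / (‖1 - (starRingEnd ℂ) (moebius z w) * z‖ ^ r *
        ‖1 - (starRingEnd ℂ) (moebius z w) * ζ‖ ^ t)) =
    1 / ((1 - ‖z‖ ^ 2) ^ (r - s - 2) * ‖1 - (starRingEnd ℂ) ζ * z‖ ^ t) *
      ((1 - ‖w‖ ^ 2) ^ s * (‖1 - (starRingEnd ℂ) w * z‖ ^ (-(2 * s + 4 - r - t)) *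
        ‖1 - (starRingEnd ℂ) w * moebius z ζ‖ ^ (-t))) := by
  have hD : 0 < 1 - ‖z‖ ^ 2 := by nlinarith [norm_nonneg z]
  have hW : 0 < 1 - ‖w‖ ^ 2 := by nlinarith [norm_nonneg w]
  have hA := norm_pos_iff.2 (one_sub_conj_mul_ne_zero hw hz)
  have hE := norm_pos_iff.2 (one_sub_conj_mul_ne_zero hζ hz)
  have hB := norm_pos_iff.2 (one_sub_conj_mul_ne_zero hw (norm_moebius_lt_one hz hζ))
  rw [one_sub_sq_norm_moebius hz hw, norm_one_sub_conj_moebius_mul_self hz hw,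
    norm_one_sub_conj_moebius_mul hz hw hζ, norm_div, norm_neg, norm_pow,
    norm_one_sub_conj_mul_comm z w, Complex.norm_of_nonneg hD.le]
  generalize 1 - ‖z‖ ^ 2 = D at *
  generalize 1 - ‖w‖ ^ 2 = W at *
  generalize ‖1 - (starRingEnd ℂ) w * z‖ = A at *
  generalize ‖1 - (starRingEnd ℂ) ζ * z‖ = E at *
  generalize ‖1 - (starRingEnd ℂ) w * moebius z ζ‖ = B at *
  rw [Real.div_rpow (by positivity) (by positivity), Real.mul_rpow hD.le hW.le,
    Real.div_rpow hD.le hA.le, Real.div_rpow (by positivity) hA.le, Real.mul_rpow hE.le hB.le,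
    show -(2 * s + 4 - r - t) = r + t - (s + s) - (4 : ℕ) by push_cast; ring,
    Real.rpow_sub_natCast hA.ne', Real.rpow_sub hA, Real.rpow_add hA, Real.rpow_add hA,
    show r - s - 2 = r - s - (2 : ℕ) by push_cast; ring,
    Real.rpow_sub_natCast hD.ne', Real.rpow_sub hD, Real.rpow_neg hB.le,
    ← Real.rpow_natCast_mul hA.le, mul_comm ((2 : ℕ) : ℝ) s, Nat.cast_ofNat, mul_two,
    Real.rpow_add hA]
  field_simp

theorem rpow_neg_mul_rpow_neg_le {a t A B : ℝ} (ht : 0 < t) (hA : 0 < A) (hA2 : A ≤ 2)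
    (hB : 0 < B) : A ^ (-a) * B ^ (-t) ≤
      2 ^ |a| * (A ^ (-(max a 0 + t)) + B ^ (-(max a 0 + t))) := by
  have hK : (1:ℝ) ≤ 2 ^ |a| := Real.one_le_rpow (by norm_num) (abs_nonneg a)
  have pA : 0 < A ^ (-(max a 0 + t)) := Real.rpow_pos_of_pos hA _
  have pB : 0 < B ^ (-(max a 0 + t)) := Real.rpow_pos_of_pos hB _
  rcases le_total a 0 with ha | ha
  · rw [max_eq_right ha, zero_add] at *
    have h1 : A ^ (-a) ≤ 2 ^ |a| := by
      rw [abs_of_nonpos ha]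
      exact Real.rpow_le_rpow hA.le hA2 (by linarith)
    calc A ^ (-a) * B ^ (-t) ≤ 2 ^ |a| * B ^ (-t) := by gcongr
      _ ≤ _ := by gcongr; linarith
  · rw [max_eq_left ha] at *
    have h1 : A ^ (-a) * B ^ (-t) ≤ A ^ (-(a + t)) + B ^ (-(a + t)) := by
      have eA : A ^ (-(a + t)) = A ^ (-a) * A ^ (-t) := by rw [← Real.rpow_add hA]; ring_nf
      have eB : B ^ (-(a + t)) = B ^ (-a) * B ^ (-t) := by rw [← Real.rpow_add hB]; ring_nf
      rcases le_total A B with h | h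
      · have : B ^ (-t) ≤ A ^ (-t) := Real.rpow_le_rpow_of_nonpos hA h (by linarith)
        have : A ^ (-a) * B ^ (-t) ≤ A ^ (-a) * A ^ (-t) := by gcongr
        linarith
      · have : A ^ (-a) ≤ B ^ (-a) := Real.rpow_le_rpow_of_nonpos hB h (by linarith)
        have : A ^ (-a) * B ^ (-t) ≤ B ^ (-a) * B ^ (-t) := by gcongr
        linarith
    nlinarith

theorem exists_lintegral_two_weights_le {s a t : ℝ} (hs : -1 < s) (ht : 0 < t) (hts : t < s + 2)
    (hats : a + t < s + 2) :
    ∃ M : ENNReal, M < ⊤ ∧ ∀ z ∈ Metric.ball (0:ℂ) 1, ∀ ξ ∈ Metric.ball (0:ℂ) 1,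
      ∫⁻ w in Metric.ball (0:ℂ) 1, ENNReal.ofReal ((1 - ‖w‖ ^ 2) ^ s *
        (‖1 - (starRingEnd ℂ) w * z‖ ^ (-a) * ‖1 - (starRingEnd ℂ) w * ξ‖ ^ (-t))) ≤ M := by
  have hc : max a 0 + t < s + 2 := by
    rcases max_cases a 0 with h | h <;> linarith
  obtain ⟨M, hM, hle⟩ := exists_lintegral_weight_le (c := max a 0 + t) hs
    (by linarith [le_max_right a 0]) hc
  refine ⟨ENNReal.ofReal (2 ^ |a|) * (M + M),
    ENNReal.mul_lt_top ENNReal.ofReal_lt_top (ENNReal.add_lt_top.2 ⟨hM, hM⟩), ?_⟩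
  intro z hz ξ hξ
  refine le_trans ?_ (mul_le_mul_right (add_le_add (hle z hz) (hle ξ hξ)) _)
  rw [← lintegral_add_left (by fun_prop), ← lintegral_const_mul _ (by fun_prop)]
  refine setLIntegral_mono (by fun_prop) fun w hw => ?_
  rw [mem_ball_zero_iff] at hz hξ hw
  have hW : (0:ℝ) ≤ (1 - ‖w‖ ^ 2) ^ s := Real.rpow_nonneg (by nlinarith [norm_nonneg w]) _
  have hA := norm_pos_iff.2 (one_sub_conj_mul_ne_zero hw hz)
  have hB := norm_pos_iff.2 (one_sub_conj_mul_ne_zero hw hξ)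
  have hA2 : ‖1 - (starRingEnd ℂ) w * z‖ ≤ 2 := by
    have := norm_sub_le (1 : ℂ) ((starRingEnd ℂ) w * z)
    rw [norm_one] at this
    linarith [norm_conj_mul_lt_one hw hz]
  rw [← ENNReal.ofReal_add (by positivity) (by positivity), ← ENNReal.ofReal_mul (by positivity)]
  refine ENNReal.ofReal_le_ofReal ?_
  calc _ ≤ (1 - ‖w‖ ^ 2) ^ s * _ :=
        mul_le_mul_of_nonneg_left (rpow_neg_mul_rpow_neg_le ht hA hA2 hB) hW
    _ = _ := by ring

end BergmanDisc

theorem stmt0 (s r t : ℝ) (hs : -1 < s) (hr : 0 < r) (ht : 0 < t)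
    (h1 : t < s + 2) (h2 : s + 2 < r) :
    ∃ C : ℝ, 0 < C ∧ ∀ z ∈ Metric.ball (0:ℂ) 1, ∀ ζ ∈ Metric.ball (0:ℂ) 1,
      (∫ η in Metric.ball (0:ℂ) 1,
        (1 - ‖η‖ ^ 2) ^ s / (‖1 - (starRingEnd ℂ) η * z‖ ^ r * ‖1 - (starRingEnd ℂ) η * ζ‖ ^ t))
      ≤ C / ((1 - ‖z‖ ^ 2) ^ (r - s - 2) * ‖1 - (starRingEnd ℂ) ζ * z‖ ^ t) := by
  obtain ⟨M, hM, hle⟩ := BergmanDisc.exists_lintegral_two_weights_le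
    (a := 2 * s + 4 - r - t) hs ht h1 (by linarith)
  refine ⟨M.toReal + 1, by positivity, fun z hz ζ hζ => ?_⟩
  have hz1 : ‖z‖ < 1 := by simpa using hz
  have hζ1 : ‖ζ‖ < 1 := by simpa using hζ
  set P := (1 - ‖z‖ ^ 2) ^ (r - s - 2) * ‖1 - (starRingEnd ℂ) ζ * z‖ ^ t with hPdef
  have hP : 0 < P := by
    have hD : 0 < 1 - ‖z‖ ^ 2 := by nlinarith [norm_nonneg z]
    have hE := norm_pos_iff.2 (BergmanDisc.one_sub_conj_mul_ne_zero hζ1 hz1)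
    positivity
  have hmeas : MeasurableSet (Metric.ball (0:ℂ) 1) := Metric.isOpen_ball.measurableSet
  have hbound : ∫⁻ η in Metric.ball (0:ℂ) 1, ENNReal.ofReal ((1 - ‖η‖ ^ 2) ^ s /
      (‖1 - (starRingEnd ℂ) η * z‖ ^ r * ‖1 - (starRingEnd ℂ) η * ζ‖ ^ t)) ≤
      ENNReal.ofReal (1 / P) * M := by
    rw [← BergmanDisc.image_moebius_ball hz1,
      BergmanDisc.lintegral_image_eq_lintegral_norm_deriv_sq_mul hmeas
        (fun w hw => BergmanDisc.hasDerivAt_moebius hz1 (mem_ball_zero_iff.1 hw))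
        (BergmanDisc.injOn_moebius_ball hz1)]
    refine le_trans (le_of_eq ?_) (mul_le_mul_right (hle z hz (BergmanDisc.moebius z ζ)
      (mem_ball_zero_iff.2 (BergmanDisc.norm_moebius_lt_one hz1 hζ1))) _)
    rw [← lintegral_const_mul _ (by fun_prop)]
    refine setLIntegral_congr_fun hmeas fun w hw => ?_
    rw [← ENNReal.ofReal_mul (by positivity), ← ENNReal.ofReal_mul (by positivity),
      BergmanDisc.jacobian_mul_integrand_moebius hz1 (mem_ball_zero_iff.1 hw) hζ1]
  rw [integral_eq_lintegral_of_nonneg_ae]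
  · calc _ ≤ (ENNReal.ofReal (1 / P) * M).toReal :=
          ENNReal.toReal_mono (ENNReal.mul_lt_top ENNReal.ofReal_lt_top hM).ne hbound
      _ = M.toReal / P := by
          rw [ENNReal.toReal_mul, ENNReal.toReal_ofReal (by positivity)]; ring
      _ ≤ _ := by gcongr; linarith
  · filter_upwards [ae_restrict_mem hmeas] with η hη
    rw [mem_ball_zero_iff] at hη
    have : (0:ℝ) ≤ (1 - ‖η‖ ^ 2) ^ s := Real.rpow_nonneg (by nlinarith [norm_nonneg η]) _
    exact div_nonneg this (by positivity)
  · exact Measurable.aestronglyMeasurable (by fun_prop)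
end
end

section
/- Let μ be a finite positive Borel measure on the unit circle ∂𝔻 and let σ, τ > −1. An analytic function f on 𝔻 belongs to the Dirichlet-type space D(μ), i.e. ∫_𝔻 |f'(z)|² P_μ(z) dA(z) < ∞, if and only if ∫_𝔻 ∫_𝔻 |f(z)−f(w)|² / |1−z̄w|^{4+σ+τ} · P_μ(z) (1−|z|²)^σ (1−|w|²)^τ dA(z) dA(w) < ∞. -/
open MeasureTheory

noncomputable section

/-- The Poisson integral `P_μ(z) = (1/2π) ∫_{∂𝔻} (1-|z|²)/|ζ-z|² dμ(ζ)` of a measure `μ`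
on the unit circle. -/
def poissonInt (μ : Measure ℂ) (z : ℂ) : ℝ :=
  (2 * Real.pi)⁻¹ * ∫ ζ, (1 - ‖z‖ ^ 2) / ‖ζ - z‖ ^ 2 ∂μ

lemma rpow_le_of_comparable {A s x : ℝ} (p : ℝ) (hA : 0 < A) (hs : 0 < s) (hx : 0 < x)
    (hxs : x ≤ A * s) (hsx : s ≤ A * x) : x ^ p ≤ A ^ |p| * s ^ p := by
  rcases le_total 0 p with hp | hp
  · rw [abs_of_nonneg hp, ← Real.mul_rpow hA.le hs.le]
    exact Real.rpow_le_rpow hx.le hxs hp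
  · rw [abs_of_nonpos hp, Real.rpow_neg hA.le, ← div_eq_inv_mul, ← Real.div_rpow hs.le hA.le]
    exact Real.rpow_le_rpow_of_nonpos (by positivity) ((div_le_iff₀' hA).2 hsx) hp

lemma lintegral_comp_real_smul (F : ℂ → ENNReal) {t : ℝ} (ht : 0 < t) :
    ∫⁻ x : ℂ, F (t • x) = ENNReal.ofReal (t ^ 2)⁻¹ * ∫⁻ x, F x := by
  have he : MeasurableEmbedding (fun x : ℂ ↦ t • x) := measurableEmbedding_const_smul₀ ht.ne'
  have h := Measure.map_addHaar_smul (volume : Measure ℂ) ht.ne'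
  rw [← he.lintegral_map, h, lintegral_smul_measure, Complex.finrank_real_complex,
    abs_of_pos (by positivity), smul_eq_mul]

lemma lintegral_one_sub_norm_rpow_lt_top {s : ℝ} (hs : -1 < s) :
    ∫⁻ u in Metric.ball (0:ℂ) 1, ENNReal.ofReal ((1 - ‖u‖) ^ s) < ⊤ := by
  have h1 : IntegrableOn (fun y : ℝ ↦ (1 - y) ^ s) (Set.Ioo 0 1) := by
    have := (intervalIntegral.intervalIntegrable_rpow' (a := 0) (b := 1) hs).comp_sub_left 1
    simp only [sub_zero, sub_self] at this
    exact ((intervalIntegrable_iff_integrableOn_Ioo_of_le zero_le_one).1 this.symm)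
  have h2 : IntegrableOn (fun u : ℂ ↦ (1 - ‖u‖) ^ s) (Metric.ball 0 1) := by
    refine (integrableOn_fun_norm_addHaar volume (f := fun y ↦ (1 - y) ^ s)).2 ?_
    refine Integrable.mono' h1 ?_ ?_
    · exact (by fun_prop : Measurable fun y : ℝ ↦
        y ^ (Module.finrank ℝ ℂ - 1) • (1 - y) ^ s).aestronglyMeasurable
    · filter_upwards [ae_restrict_mem measurableSet_Ioo] with y hy
      rw [Complex.finrank_real_complex]
      simp only [Set.mem_Ioo] at hy
      have : 0 ≤ (1 - y) ^ s := Real.rpow_nonneg (by linarith) s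
      simp only [Nat.add_one_sub_one, pow_one, smul_eq_mul, norm_mul, Real.norm_eq_abs,
        abs_of_nonneg this, abs_of_pos hy.1]
      nlinarith
  exact h2.lintegral_lt_top

lemma exists_lintegral_norm_rpow_le {p : ℝ} (hp : 0 < p) :
    ∃ C : ENNReal, C ≠ ⊤ ∧ ∀ (c : ℂ) (R : ℝ), 0 < R →
      ∫⁻ z in Metric.ball c R, ENNReal.ofReal (‖c - z‖ ^ (p - 2)) ≤
        C * ENNReal.ofReal (R ^ p) := by
  refine ⟨∫⁻ z in Metric.ball (0:ℂ) 1, ENNReal.ofReal (‖z‖ ^ (p - 2)), ?_, ?_⟩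
  · have h1 : IntegrableOn (fun u : ℂ ↦ ‖u‖ ^ (p - 2)) (Metric.ball 0 1) := by
      refine (integrableOn_fun_norm_addHaar volume (f := fun y ↦ y ^ (p - 2))).2 ?_
      have h2 := (intervalIntegral.intervalIntegrable_rpow' (a := 0) (b := 1)
        (by linarith : -1 < p - 1))
      refine ((intervalIntegrable_iff_integrableOn_Ioo_of_le zero_le_one).1 h2).congr_fun
        ?_ measurableSet_Ioo
      intro y hy
      simp only [Complex.finrank_real_complex, Nat.add_one_sub_one, pow_one, smul_eq_mul]
      nth_rewrite 2 [← Real.rpow_one y]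
      rw [← Real.rpow_add hy.1]
      ring_nf
    exact h1.lintegral_lt_top.ne
  · intro c R hR
    rw [← lintegral_indicator Metric.isOpen_ball.measurableSet,
      ← lintegral_add_left_eq_self _ c, ← lintegral_indicator Metric.isOpen_ball.measurableSet]
    have key := lintegral_comp_real_smul (fun x ↦ (Metric.ball c R).indicator
      (fun z ↦ ENNReal.ofReal (‖c - z‖ ^ (p - 2))) (c + x)) hR
    have e : ∀ x : ℂ, (Metric.ball c R).indicator
      (fun z ↦ ENNReal.ofReal (‖c - z‖ ^ (p - 2))) (c + R • x) =
      ENNReal.ofReal (R ^ (p - 2)) * (Metric.ball (0:ℂ) 1).indicator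
        (fun z ↦ ENNReal.ofReal (‖z‖ ^ (p - 2))) x := by
      intro x
      by_cases hx : ‖x‖ < 1
      · rw [Set.indicator_of_mem, Set.indicator_of_mem, ← ENNReal.ofReal_mul (by positivity),
          ← Real.mul_rpow hR.le (norm_nonneg _)]
        · simp [abs_of_pos hR]
        · simpa using hx
        · simpa [abs_of_pos hR] using mul_lt_of_lt_one_right hR hx
      · rw [Set.indicator_of_notMem, Set.indicator_of_notMem, mul_zero]
        · simpa using hx
        · simpa [abs_of_pos hR] using le_mul_of_one_le_right hR.le (not_lt.1 hx)
    simp only [e] at key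
    rw [lintegral_const_mul' _ _ ENNReal.ofReal_ne_top] at key
    have h3 : R ^ p = R ^ 2 * R ^ (p - 2) := by
      rw [← Real.rpow_natCast, ← Real.rpow_add hR]; push_cast; ring_nf
    rw [mul_comm, h3, ENNReal.ofReal_mul (by positivity), mul_assoc, key, ← mul_assoc,
      ← ENNReal.ofReal_mul (by positivity), mul_inv_cancel₀ (by positivity), ENNReal.ofReal_one,
      one_mul]

lemma exists_lintegral_add_norm_rpow_le {c : ℝ} (hc : 0 < c) :
    ∃ C : ENNReal, C ≠ ⊤ ∧ ∀ (w : ℂ) (δ : ℝ), 0 < δ →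
      ∫⁻ z, ENNReal.ofReal ((δ + ‖z - w‖) ^ (-(2 + c))) ≤ C * ENNReal.ofReal (δ ^ (-c)) := by
  refine ⟨∫⁻ z : ℂ, ENNReal.ofReal ((1 + ‖z‖) ^ (-(2 + c))), ?_, ?_⟩
  · exact (finite_integral_one_add_norm (by simp; linarith)).ne
  · intro w δ hδ
    rw [lintegral_sub_right_eq_self (fun z ↦ ENNReal.ofReal ((δ + ‖z‖) ^ (-(2 + c)))) w]
    have key := lintegral_comp_real_smul (fun x ↦ ENNReal.ofReal ((1 + ‖x‖) ^ (-(2 + c))))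
      (inv_pos.2 hδ)
    have e : ∀ x : ℂ, ENNReal.ofReal ((δ + ‖x‖) ^ (-(2 + c))) = ENNReal.ofReal (δ ^ (-(2 + c))) *
        ENNReal.ofReal ((1 + ‖δ⁻¹ • x‖) ^ (-(2 + c))) := by
      intro x
      rw [← ENNReal.ofReal_mul (by positivity), ← Real.mul_rpow hδ.le (by positivity), norm_smul,
        mul_add, Real.norm_eq_abs, abs_of_pos (inv_pos.2 hδ), mul_inv_cancel_left₀ hδ.ne', mul_one]
    simp only [e]
    rw [lintegral_const_mul' _ _ ENNReal.ofReal_ne_top, key, ← mul_assoc, mul_comm,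
      ← ENNReal.ofReal_mul (by positivity)]
    gcongr
    rw [inv_pow, inv_inv, ← Real.rpow_natCast, ← Real.rpow_add hδ]
    apply le_of_eq; congr 1; push_cast; ring

lemma measurable_indicator_of_continuousOn {h : ℂ → ℂ} {s : Set ℂ} (hs : IsOpen s)
    (hh : ContinuousOn h s) : Measurable (s.indicator h) := by
  classical
  rw [← Set.piecewise_eq_indicator]
  exact hh.measurable_piecewise continuousOn_const hs.measurableSet

lemma ofReal_norm_sq_le_lintegral_circle {h : ℂ → ℂ} {c : ℂ} {r : ℝ} (hr : 0 < r)
    (hh : DiffContOnCl ℂ h (Metric.ball c r)) :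
    ENNReal.ofReal (2 * Real.pi * ‖h c‖ ^ 2) ≤
      ∫⁻ θ in Set.Ioo (-Real.pi) Real.pi, ENNReal.ofReal (‖h (circleMap c r θ)‖ ^ 2) := by
  have h2 : DiffContOnCl ℂ (fun z ↦ h z * h z) (Metric.ball c |r|) := by
    rw [abs_of_pos hr]; exact hh.smul hh
  have h3 := h2.circleAverage
  rw [Real.circleAverage_eq_integral_add (-Real.pi), intervalIntegral.integral_comp_add_right
    (fun θ ↦ h (circleMap c r θ) * h (circleMap c r θ))] at h3
  have h4 : ENNReal.ofReal (2 * Real.pi * ‖h c‖ ^ 2) =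
      ‖∫ θ in (0 + -Real.pi)..(2 * Real.pi + -Real.pi),
        h (circleMap c r θ) * h (circleMap c r θ)‖ₑ := by
    rw [← ofReal_norm]
    congr 1
    have := congrArg norm h3
    rw [norm_smul, norm_mul, Real.norm_eq_abs, abs_of_pos (by positivity)] at this
    rw [pow_two, ← this]
    field_simp
  rw [h4, zero_add, show 2 * Real.pi + -Real.pi = Real.pi by ring,
    intervalIntegral.integral_of_le (by linarith [Real.pi_pos]), integral_Ioc_eq_integral_Ioo]
  refine (enorm_integral_le_lintegral_enorm _).trans_eq ?_
  congr 1; ext θ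
  rw [← ofReal_norm, norm_mul, pow_two]

lemma ofReal_norm_sq_le_lintegral_ball {h : ℂ → ℂ} {c : ℂ} {R : ℝ} (hR : 0 < R)
    (hh : DifferentiableOn ℂ h (Metric.ball c R)) :
    ENNReal.ofReal (‖h c‖ ^ 2 * (Real.pi / 2 * R ^ 4)) ≤
      ∫⁻ w in Metric.ball c R, ENNReal.ofReal (‖h w‖ ^ 2 * ‖w - c‖ ^ 2) := by
  set H := (Metric.ball c R).indicator h with hH
  have hHm : Measurable H := measurable_indicator_of_continuousOn Metric.isOpen_ball hh.continuousOn
  have e1 : ∫⁻ w in Metric.ball c R, ENNReal.ofReal (‖h w‖ ^ 2 * ‖w - c‖ ^ 2) =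
      ∫⁻ x, ENNReal.ofReal (‖H (c + x)‖ ^ 2 * ‖x‖ ^ 2) := by
    rw [← lintegral_indicator Metric.isOpen_ball.measurableSet, ← lintegral_add_left_eq_self _ c]
    congr 1; ext x
    by_cases hx : c + x ∈ Metric.ball c R
    · simp only [hH, Set.indicator_of_mem hx, add_sub_cancel_left]
    · simp [hH, Set.indicator_of_notMem hx]
  rw [e1, ← Complex.lintegral_comp_polarCoord_symm, polarCoord_target,
    Measure.volume_eq_prod, ← Measure.prod_restrict, lintegral_prod]
  swap
  · refine Measurable.aemeasurable ?_
    simp only [Complex.polarCoord_symm_apply]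
    fun_prop
  have key : ∀ r ∈ Set.Ioo 0 R, ENNReal.ofReal (2 * Real.pi * ‖h c‖ ^ 2 * r ^ 3) ≤
      ∫⁻ θ in Set.Ioo (-Real.pi) Real.pi, ENNReal.ofReal r •
        ENNReal.ofReal (‖H (c + Complex.polarCoord.symm (r, θ))‖ ^ 2 *
          ‖Complex.polarCoord.symm (r, θ)‖ ^ 2) := by
    intro r hr
    have hd : DiffContOnCl ℂ h (Metric.ball c r) :=
      hh.diffContOnCl_ball (Metric.closedBall_subset_ball hr.2)
    have := ofReal_norm_sq_le_lintegral_circle hr.1 hd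
    have h0 : (0:ℝ) ≤ r ^ 3 := by have := hr.1; positivity
    rw [ENNReal.ofReal_mul' h0]
    grw [this]
    rw [← lintegral_mul_const' _ _ ENNReal.ofReal_ne_top]
    refine le_of_eq (lintegral_congr fun θ ↦ ?_)
    have e2 : c + Complex.polarCoord.symm (r, θ) = circleMap c r θ := by
      simp [circleMap, Complex.polarCoord_symm_apply, Complex.exp_mul_I]
    have e3 : H (circleMap c r θ) = h (circleMap c r θ) := by
      refine Set.indicator_of_mem ?_ _
      rw [← e2]; simpa [abs_of_pos hr.1] using hr.2
    rw [e2, e3, Complex.norm_polarCoord_symm, smul_eq_mul, ← ENNReal.ofReal_mul hr.1.le,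
      ← ENNReal.ofReal_mul (by positivity)]
    simp only [sq_abs]
    congr 1; ring
  calc ENNReal.ofReal (‖h c‖ ^ 2 * (Real.pi / 2 * R ^ 4))
      = ENNReal.ofReal (∫ r in (0:ℝ)..R, 2 * Real.pi * ‖h c‖ ^ 2 * r ^ 3) := by
        rw [intervalIntegral.integral_const_mul, integral_pow]
        congr 1; norm_num; ring
    _ = ∫⁻ r in Set.Ioo 0 R, ENNReal.ofReal (2 * Real.pi * ‖h c‖ ^ 2 * r ^ 3) := by
        rw [intervalIntegral.integral_of_le hR.le, integral_Ioc_eq_integral_Ioo,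
          ofReal_integral_eq_lintegral_ofReal]
        · exact (by fun_prop : Continuous fun r : ℝ ↦
            2 * Real.pi * ‖h c‖ ^ 2 * r ^ 3).integrableOn_Icc.mono_set Set.Ioo_subset_Icc_self
        · filter_upwards [ae_restrict_mem measurableSet_Ioo] with r hr
          have := hr.1
          simp only [Pi.zero_apply]
          positivity
    _ ≤ _ := (setLIntegral_mono' measurableSet_Ioo key).trans
        (lintegral_mono_set Set.Ioo_subset_Ioi_self)

lemma norm_one_sub_conj_mul_sq (z w : ℂ) : ‖1 - (starRingEnd ℂ) z * w‖ ^ 2 =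
    ‖z - w‖ ^ 2 + (1 - ‖z‖ ^ 2) * (1 - ‖w‖ ^ 2) := by
  simp only [Complex.sq_norm, Complex.normSq_apply, Complex.sub_re, Complex.sub_im, Complex.mul_re,
    Complex.mul_im, Complex.conj_re, Complex.conj_im, Complex.one_re, Complex.one_im]
  ring

lemma norm_sub_le_norm_one_sub_conj_mul {z w : ℂ} (hz : ‖z‖ < 1) (hw : ‖w‖ < 1) :
    ‖z - w‖ ≤ ‖1 - (starRingEnd ℂ) z * w‖ := by
  refine (sq_le_sq₀ (norm_nonneg _) (norm_nonneg _)).1 ?_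
  rw [norm_one_sub_conj_mul_sq]
  have h1 : 0 ≤ 1 - ‖z‖ ^ 2 := by nlinarith [norm_nonneg z]
  have h2 : 0 ≤ 1 - ‖w‖ ^ 2 := by nlinarith [norm_nonneg w]
  nlinarith [mul_nonneg h1 h2]

lemma one_sub_norm_mul_norm_le (z w : ℂ) :
    1 - ‖z‖ * ‖w‖ ≤ ‖1 - (starRingEnd ℂ) z * w‖ := by
  have := norm_sub_norm_le (1 : ℂ) ((starRingEnd ℂ) z * w)
  simpa using this

lemma one_sub_norm_le_left {z w : ℂ} (hw : ‖w‖ < 1) :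
    1 - ‖z‖ ≤ ‖1 - (starRingEnd ℂ) z * w‖ := by
  nlinarith [one_sub_norm_mul_norm_le z w, norm_nonneg z]

lemma one_sub_norm_le_right {z w : ℂ} (hz : ‖z‖ < 1) :
    1 - ‖w‖ ≤ ‖1 - (starRingEnd ℂ) z * w‖ := by
  nlinarith [one_sub_norm_mul_norm_le z w, norm_nonneg w]

lemma exists_lintegral_norm_one_sub_conj_mul_rpow_le {c : ℝ} (hc : 0 < c) :
    ∃ C : ENNReal, C ≠ ⊤ ∧ ∀ w : ℂ, ‖w‖ < 1 →
      ∫⁻ z in Metric.ball (0:ℂ) 1, ENNReal.ofReal (‖1 - (starRingEnd ℂ) z * w‖ ^ (-(2 + c))) ≤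
        C * ENNReal.ofReal ((1 - ‖w‖) ^ (-c)) := by
  obtain ⟨C, hC, h⟩ := exists_lintegral_add_norm_rpow_le hc
  refine ⟨ENNReal.ofReal (2 ^ (2 + c)) * C, ENNReal.mul_ne_top ENNReal.ofReal_ne_top hC, ?_⟩
  intro w hw
  rw [mul_assoc]
  grw [← h w (1 - ‖w‖) (by linarith), ← lintegral_const_mul' _ _ ENNReal.ofReal_ne_top,
    ← setLIntegral_le_lintegral (Metric.ball 0 1)]
  refine setLIntegral_mono' Metric.isOpen_ball.measurableSet fun z hz ↦ ?_
  have hz : ‖z‖ < 1 := by simpa using hz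
  rw [← ENNReal.ofReal_mul (by positivity)]
  refine ENNReal.ofReal_le_ofReal ?_
  have h1 := norm_sub_le_norm_one_sub_conj_mul hz hw
  have h2 := one_sub_norm_le_right (w := w) hz
  have h3 : 0 < 1 - ‖w‖ + ‖z - w‖ := by linarith [norm_nonneg (z - w)]
  calc _ ≤ ((1 - ‖w‖ + ‖z - w‖) / 2) ^ (-(2 + c)) :=
        Real.rpow_le_rpow_of_nonpos (by linarith) (by linarith) (by linarith)
    _ = _ := by
        rw [Real.div_rpow h3.le (by norm_num), Real.rpow_neg (by norm_num : (0:ℝ) ≤ 2),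
          div_inv_eq_mul, mul_comm]

lemma poisson_kernel_pointwise_far {σ τ x d e E : ℝ} (hσ : -1 < σ)
    (hx : 0 < x) (hd : 0 < d) (hE : 0 < E) (hxd : x ≤ 2 * d) (heE : E / 2 ≤ e) :
    x / e ^ 2 * (x ^ σ / d ^ (4 + σ + τ)) ≤
      4 * 2 ^ (σ + 1) / E ^ 2 * d ^ (-(2 + (1 + τ))) := by
  have h1 : x * x ^ σ ≤ 2 ^ (σ + 1) * d ^ (σ + 1) := by
    rw [← Real.mul_rpow (by norm_num) hd.le, mul_comm, ← Real.rpow_add_one hx.ne']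
    exact Real.rpow_le_rpow hx.le hxd (by linarith)
  have h2 : 1 / e ^ 2 ≤ 4 / E ^ 2 := by
    rw [div_le_div_iff₀ (by nlinarith) (by positivity)]
    nlinarith
  calc x / e ^ 2 * (x ^ σ / d ^ (4 + σ + τ)) = 1 / e ^ 2 * (x * x ^ σ) * d ^ (-(4 + σ + τ)) := by
        rw [Real.rpow_neg hd.le]; field_simp
    _ ≤ 4 / E ^ 2 * (2 ^ (σ + 1) * d ^ (σ + 1)) * d ^ (-(4 + σ + τ)) := by gcongr
    _ = 4 * 2 ^ (σ + 1) / E ^ 2 * (d ^ (σ + 1) * d ^ (-(4 + σ + τ))) := by ring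
    _ = _ := by rw [← Real.rpow_add hd]; ring_nf

lemma poisson_kernel_pointwise_near {σ τ x d e E δ : ℝ} (hσ : -1 < σ) (hτ : -1 < τ)
    (hx : 0 < x) (hd : 0 < d) (he : 0 < e) (hE : 0 < E) (hδ : 0 < δ)
    (hxe : x ≤ 2 * e) (hδd : δ ≤ d) (hEd : E / 2 ≤ d) :
    x / e ^ 2 * (x ^ σ / d ^ (4 + σ + τ)) ≤
      2 ^ (σ + 1) * (E / 2) ^ (-(3 + σ)) * δ ^ (-(1 + τ)) * e ^ ((σ + 1) - 2) := by
  have h1 : x * x ^ σ ≤ 2 ^ (σ + 1) * e ^ (σ + 1) := by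
    rw [← Real.mul_rpow (by norm_num) he.le, mul_comm, ← Real.rpow_add_one hx.ne']
    exact Real.rpow_le_rpow hx.le hxe (by linarith)
  have h2 : d ^ (-(3 + σ)) ≤ (E / 2) ^ (-(3 + σ)) :=
    Real.rpow_le_rpow_of_nonpos (by positivity) hEd (by linarith)
  have h3 : d ^ (-(1 + τ)) ≤ δ ^ (-(1 + τ)) :=
    Real.rpow_le_rpow_of_nonpos hδ hδd (by linarith)
  calc x / e ^ 2 * (x ^ σ / d ^ (4 + σ + τ)) = (x * x ^ σ) * d ^ (-(4 + σ + τ)) / e ^ 2 := by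
        rw [Real.rpow_neg hd.le]; field_simp
    _ = (x * x ^ σ) * (d ^ (-(3 + σ)) * d ^ (-(1 + τ))) / e ^ 2 := by
        rw [← Real.rpow_add hd]; ring_nf
    _ ≤ (2 ^ (σ + 1) * e ^ (σ + 1)) * ((E / 2) ^ (-(3 + σ)) * δ ^ (-(1 + τ))) / e ^ 2 := by
        gcongr
    _ = _ := by rw [Real.rpow_sub he, Real.rpow_two]; ring

lemma exists_lintegral_poisson_kernel_le {σ τ : ℝ} (hσ : -1 < σ) (hτ : -1 < τ) :
    ∃ C : ENNReal, C ≠ ⊤ ∧ ∀ ζ w : ℂ, ‖ζ‖ = 1 → ‖w‖ < 1 →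
      (∫⁻ z in Metric.ball (0:ℂ) 1, ENNReal.ofReal ((1 - ‖z‖ ^ 2) / ‖ζ - z‖ ^ 2 *
        ((1 - ‖z‖ ^ 2) ^ σ / ‖1 - (starRingEnd ℂ) z * w‖ ^ (4 + σ + τ)))) *
          ENNReal.ofReal ((1 - ‖w‖ ^ 2) ^ (2 + τ)) ≤
        C * ENNReal.ofReal ((1 - ‖w‖ ^ 2) / ‖ζ - w‖ ^ 2) := by
  obtain ⟨C₁, hC₁, h₁⟩ := exists_lintegral_norm_one_sub_conj_mul_rpow_le
    (by linarith : 0 < 1 + τ)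
  obtain ⟨C₂, hC₂, h₂⟩ := exists_lintegral_norm_rpow_le (by linarith : 0 < σ + 1)
  set k := ENNReal.ofReal (4 * 2 ^ (σ + 1) * 2 ^ (1 + τ)) with hk
  refine ⟨k * (C₁ + C₂), by finiteness, ?_⟩
  intro ζ w hζ hw
  set E := ‖ζ - w‖ with hEdef
  have hE : 0 < E := by
    have := norm_sub_norm_le ζ w
    linarith
  set δ := 1 - ‖w‖ with hδdef
  have hδ : 0 < δ := by linarith
  set X := 1 - ‖w‖ ^ 2 with hXdef
  have hX : 0 < X := by nlinarith [norm_nonneg w]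
  have hXδ : X ≤ 2 * δ := by nlinarith [norm_nonneg w]
  have pt : ∀ z ∈ Metric.ball (0:ℂ) 1, ENNReal.ofReal ((1 - ‖z‖ ^ 2) / ‖ζ - z‖ ^ 2 *
        ((1 - ‖z‖ ^ 2) ^ σ / ‖1 - (starRingEnd ℂ) z * w‖ ^ (4 + σ + τ))) ≤
      ENNReal.ofReal (4 * 2 ^ (σ + 1) / E ^ 2) *
        ENNReal.ofReal (‖1 - (starRingEnd ℂ) z * w‖ ^ (-(2 + (1 + τ)))) +
      ENNReal.ofReal (2 ^ (σ + 1) * (E / 2) ^ (-(3 + σ)) * δ ^ (-(1 + τ))) *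
        (Metric.ball ζ (E / 2)).indicator (fun z ↦ ENNReal.ofReal (‖ζ - z‖ ^ ((σ + 1) - 2))) z := by
    intro z hz
    have hz : ‖z‖ < 1 := by simpa using hz
    have hx : 0 < 1 - ‖z‖ ^ 2 := by nlinarith [norm_nonneg z]
    have hd0 := one_sub_norm_le_left (z := z) hw
    have hd : 0 < ‖1 - (starRingEnd ℂ) z * w‖ := by linarith
    by_cases heE : E / 2 ≤ ‖ζ - z‖
    · refine le_add_right ?_
      rw [← ENNReal.ofReal_mul (by positivity)]
      exact ENNReal.ofReal_le_ofReal (poisson_kernel_pointwise_far hσ hx hd hE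
        (by nlinarith [norm_nonneg z]) heE)
    · refine le_add_left ?_
      have hzt := norm_sub_norm_le ζ z
      rw [Set.indicator_of_mem, ← ENNReal.ofReal_mul (by positivity)]
      · refine ENNReal.ofReal_le_ofReal (poisson_kernel_pointwise_near hσ hτ hx hd
          (by linarith) hE hδ ?_ (one_sub_norm_le_right hz) ?_)
        · nlinarith [norm_nonneg z]
        · have h1 := norm_sub_le_norm_one_sub_conj_mul hz hw
          have h2 := norm_sub_le_norm_sub_add_norm_sub ζ z w
          linarith
      · rw [Metric.mem_ball, dist_comm, dist_eq_norm]; linarith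
  have hXp : X ^ (2 + τ) * δ ^ (-(1 + τ)) ≤ 2 ^ (1 + τ) * X := by
    have : δ ^ (-(1 + τ)) ≤ (X / 2) ^ (-(1 + τ)) :=
      Real.rpow_le_rpow_of_nonpos (by positivity) (by linarith) (by linarith)
    calc _ ≤ X ^ (2 + τ) * (X / 2) ^ (-(1 + τ)) := by gcongr
      _ = X ^ (2 + τ) * X ^ (-(1 + τ)) * 2 ^ (1 + τ) := by
        rw [Real.div_rpow hX.le (by norm_num), Real.rpow_neg (by norm_num : (0:ℝ) ≤ 2)]
        field_simp
      _ = _ := by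
        rw [← Real.rpow_add hX, show 2 + τ + -(1 + τ) = 1 by ring, Real.rpow_one, mul_comm]
  have hEp : (E / 2) ^ (-(3 + σ)) * (E / 2) ^ (σ + 1) = 4 / E ^ 2 := by
    rw [← Real.rpow_add (by positivity), show -(3 + σ) + (σ + 1) = -2 by ring,
      Real.rpow_neg (by positivity), Real.rpow_two]
    field_simp; norm_num
  grw [setLIntegral_mono' Metric.isOpen_ball.measurableSet pt]
  rw [lintegral_add_left (by fun_prop), lintegral_const_mul' _ _ ENNReal.ofReal_ne_top,
    lintegral_const_mul' _ _ ENNReal.ofReal_ne_top]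
  grw [h₁ w hw, setLIntegral_le_lintegral _ (Set.indicator _ _),
    lintegral_indicator Metric.isOpen_ball.measurableSet, h₂ ζ (E / 2) (by positivity)]
  rw [add_mul, mul_add, add_mul]
  refine add_le_add ?_ ?_
  · calc _ = C₁ * ENNReal.ofReal (4 * 2 ^ (σ + 1) / E ^ 2 * (X ^ (2 + τ) * δ ^ (-(1 + τ)))) := by
          rw [ENNReal.ofReal_mul (by positivity), ENNReal.ofReal_mul (by positivity)]; ring
      _ ≤ C₁ * ENNReal.ofReal (4 * 2 ^ (σ + 1) / E ^ 2 * (2 ^ (1 + τ) * X)) := by gcongr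
      _ = _ := by
        rw [mul_comm k, mul_assoc C₁, hk, ← ENNReal.ofReal_mul (by positivity)]; congr 2; ring
  · calc _ = C₂ * ENNReal.ofReal (2 ^ (σ + 1) * ((E / 2) ^ (-(3 + σ)) * (E / 2) ^ (σ + 1)) *
            (X ^ (2 + τ) * δ ^ (-(1 + τ)))) := by
          have : 2 ^ (σ + 1) * ((E / 2) ^ (-(3 + σ)) * (E / 2) ^ (σ + 1)) *
              (X ^ (2 + τ) * δ ^ (-(1 + τ))) = 2 ^ (σ + 1) * (E / 2) ^ (-(3 + σ)) *
              δ ^ (-(1 + τ)) * (E / 2) ^ (σ + 1) * X ^ (2 + τ) := by ring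
          rw [this, ENNReal.ofReal_mul (p := _ * (E / 2) ^ (σ + 1)) (by positivity),
            ENNReal.ofReal_mul (q := (E / 2) ^ (σ + 1)) (by positivity)]
          ring
      _ ≤ C₂ * ENNReal.ofReal (2 ^ (σ + 1) * ((E / 2) ^ (-(3 + σ)) * (E / 2) ^ (σ + 1)) *
            (2 ^ (1 + τ) * X)) := by gcongr
      _ = _ := by
        rw [mul_comm k, mul_assoc C₂, hk, ← ENNReal.ofReal_mul (by positivity), hEp]; congr 2; ring

lemma lintegral_Ioo_sub_rpow {γ ρ : ℝ} (hγ : -1 < γ) (hρ : ρ < 1) :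
    ∫⁻ t in Set.Ioo ρ 1, ENNReal.ofReal ((t - ρ) ^ γ) =
      ENNReal.ofReal ((1 - ρ) ^ (γ + 1) / (γ + 1)) := by
  have hi : IntegrableOn (fun t ↦ (t - ρ) ^ γ) (Set.Ioo ρ 1) := by
    have := (intervalIntegral.intervalIntegrable_rpow' (a := 0) (b := 1 - ρ) hγ).comp_sub_right ρ
    simp only [zero_add, sub_add_cancel] at this
    exact (intervalIntegrable_iff_integrableOn_Ioo_of_le hρ.le).1 this
  rw [← ofReal_integral_eq_lintegral_ofReal hi, ← integral_Ioc_eq_integral_Ioo,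
    ← intervalIntegral.integral_of_le hρ.le,
    intervalIntegral.integral_comp_sub_right (fun t ↦ t ^ γ), integral_rpow (Or.inl hγ), sub_self,
    Real.zero_rpow (by linarith), sub_zero]
  filter_upwards [ae_restrict_mem measurableSet_Ioo] with t ht
  exact Real.rpow_nonneg (by linarith [ht.1]) γ

lemma lintegral_mul_one_sub_mul_rpow_le {ε r : ℝ} (hε : 0 < ε) (hr : 0 ≤ r) (hr1 : r < 1) :
    ∫⁻ t in Set.Ioo (1 / 2 : ℝ) 1, ENNReal.ofReal (r * (1 - t * r) ^ (-(1 + ε))) ≤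
      ENNReal.ofReal ((1 - r) ^ (-ε) / ε) := by
  have hpos : ∀ t ∈ Set.Icc (1 / 2 : ℝ) 1, 0 < 1 - t * r := fun t ht ↦ by
    nlinarith [ht.1, ht.2]
  have hc : ContinuousOn (fun t ↦ r * (1 - t * r) ^ (-(1 + ε))) (Set.Icc (1 / 2 : ℝ) 1) :=
    continuousOn_const.mul (ContinuousOn.rpow_const (by fun_prop) fun t ht ↦ Or.inl (hpos t ht).ne')
  have hd : ∀ t ∈ Set.uIcc (1 / 2 : ℝ) 1, HasDerivAt (fun t ↦ (1 - t * r) ^ (-ε) / ε)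
      (r * (1 - t * r) ^ (-(1 + ε))) t := by
    intro t ht
    rw [Set.uIcc_of_le (by norm_num)] at ht
    have h1 : HasDerivAt (fun t ↦ 1 - t * r) (-r) t := by
      simpa using ((hasDerivAt_id t).mul_const r).const_sub 1
    refine ((h1.rpow_const (p := -ε) (Or.inl (hpos t ht).ne')).div_const ε).congr_deriv ?_
    rw [show -ε - 1 = -(1 + ε) by ring]
    field_simp
  have hi := hc.integrableOn_Icc.mono_set Set.Ioo_subset_Icc_self (μ := volume)
  rw [← ofReal_integral_eq_lintegral_ofReal hi, ← integral_Ioc_eq_integral_Ioo,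
    ← intervalIntegral.integral_of_le (by norm_num),
    intervalIntegral.integral_eq_sub_of_hasDerivAt hd]
  · refine ENNReal.ofReal_le_ofReal ?_
    rw [one_mul]
    have := Real.rpow_nonneg (hpos (1 / 2) (by norm_num)).le (-ε)
    have : 0 ≤ (1 - 1 / 2 * r) ^ (-ε) / ε := by positivity
    linarith
  · exact (hc.mono (by rw [Set.uIcc_of_le (by norm_num)])).intervalIntegrable
  · filter_upwards [ae_restrict_mem measurableSet_Ioo] with t ht
    have := hpos t (Set.Ioo_subset_Icc_self ht)
    simp only [Pi.zero_apply]
    positivity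

lemma lintegral_sq_le_mul_of_mul {α : Type*} [MeasurableSpace α] {μ : Measure α}
    {F G : α → ENNReal} (hF : AEMeasurable F μ) (hG : AEMeasurable G μ) :
    (∫⁻ t, F t * G t ∂μ) ^ 2 ≤ (∫⁻ t, F t ^ 2 ∂μ) * ∫⁻ t, G t ^ 2 ∂μ := by
  have h := ENNReal.lintegral_mul_le_Lp_mul_Lq μ Real.HolderConjugate.two_two hF hG
  simp only [Pi.mul_apply, ENNReal.rpow_two] at h
  grw [h]
  rw [mul_pow, ← ENNReal.rpow_two, ← ENNReal.rpow_two, ← ENNReal.rpow_mul, ← ENNReal.rpow_mul]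
  norm_num

lemma ofReal_norm_sub_half_sq_le {g : ℂ → ℂ} (hg : DifferentiableOn ℂ g (Metric.ball 0 1))
    {ε : ℝ} (hε : 0 < ε) {u : ℂ} (hu : ‖u‖ < 1) :
    ENNReal.ofReal (‖g u - g ((1 / 2 : ℝ) • u)‖ ^ 2) ≤
      ENNReal.ofReal (ε⁻¹ * (1 - ‖u‖) ^ (-ε)) * ∫⁻ t in Set.Ioo (1 / 2 : ℝ) 1,
        ENNReal.ofReal (‖deriv g (t • u)‖ ^ 2 * (1 - ‖t • u‖) ^ (1 + ε)) := by
  have hmem : ∀ t ∈ Set.Icc (1 / 2 : ℝ) 1, t • u ∈ Metric.ball (0:ℂ) 1 := fun t ht ↦ by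
    have : 0 ≤ t := by linarith [ht.1]
    simp only [Metric.mem_ball, dist_zero_right, norm_smul, Real.norm_eq_abs, abs_of_nonneg this]
    nlinarith [norm_nonneg u, ht.2]
  have hgd := hg.deriv Metric.isOpen_ball
  have hcont : ContinuousOn (fun t : ℝ ↦ deriv g (t • u) * u) (Set.Icc (1 / 2 : ℝ) 1) := by
    refine ContinuousOn.mul ?_ continuousOn_const
    exact hgd.continuousOn.comp (by fun_prop) hmem
  have hFTC : ∫ t in (1 / 2 : ℝ)..1, deriv g (t • u) * u = g u - g ((1 / 2 : ℝ) • u) := by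
    have := intervalIntegral.integral_eq_sub_of_hasDerivAt (f := fun t : ℝ ↦ g (t • u))
      (f' := fun t : ℝ ↦ deriv g (t • u) * u) (a := 1 / 2) (b := 1) ?_ ?_
    · simpa using this
    · intro t ht
      rw [Set.uIcc_of_le (by norm_num)] at ht
      have h1 := (hg.differentiableAt (Metric.isOpen_ball.mem_nhds (hmem t ht))).hasDerivAt
      have h2 : HasDerivAt (fun t : ℝ ↦ t • u) u t := by
        simpa using (hasDerivAt_id t).smul_const u
      exact h1.comp_of_eq t h2 rfl
    · exact (hcont.mono (by rw [Set.uIcc_of_le (by norm_num)])).intervalIntegrable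
  have hpos : ∀ t ∈ Set.Ioo (1 / 2 : ℝ) 1, 0 < 1 - ‖t • u‖ := fun t ht ↦ by
    simpa using hmem t (Set.Ioo_subset_Icc_self ht)
  have h1 : ENNReal.ofReal ‖g u - g ((1 / 2 : ℝ) • u)‖ ≤ ∫⁻ t in Set.Ioo (1 / 2 : ℝ) 1,
      ENNReal.ofReal (‖deriv g (t • u)‖ * (1 - ‖t • u‖) ^ ((1 + ε) / 2)) *
      ENNReal.ofReal (‖u‖ * (1 - ‖t • u‖) ^ (-((1 + ε) / 2))) := by
    rw [← hFTC, intervalIntegral.integral_of_le (by norm_num), integral_Ioc_eq_integral_Ioo,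
      ofReal_norm]
    refine (enorm_integral_le_lintegral_enorm _).trans_eq ?_
    refine setLIntegral_congr_fun measurableSet_Ioo fun t ht ↦ ?_
    have := hpos t ht
    rw [← ENNReal.ofReal_mul (by positivity), ← ofReal_norm, norm_mul, Real.rpow_neg this.le]
    congr 1
    field_simp
  rw [ENNReal.ofReal_pow (norm_nonneg _)]
  have hdm : Measurable (deriv g) := measurable_deriv g
  grw [h1, lintegral_sq_le_mul_of_mul (by fun_prop) (by fun_prop)]
  rw [mul_comm]
  refine mul_le_mul' ?_ (le_of_eq ?_)
  · refine le_trans ?_ ((lintegral_mul_one_sub_mul_rpow_le hε (norm_nonneg u) hu).trans_eq ?_)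
    · refine setLIntegral_mono' measurableSet_Ioo fun t ht ↦ ?_
      have h2 := hpos t ht
      rw [← ENNReal.ofReal_pow (by positivity)]
      refine ENNReal.ofReal_le_ofReal ?_
      have h3 : ‖t • u‖ = t * ‖u‖ := by
        rw [norm_smul, Real.norm_eq_abs, abs_of_pos (by linarith [ht.1])]
      rw [h3] at h2 ⊢
      rw [mul_pow, ← Real.rpow_mul_natCast h2.le]
      have h4 : ‖u‖ ^ 2 ≤ ‖u‖ := by nlinarith [norm_nonneg u]
      grw [h4]
      apply le_of_eq; congr 2; push_cast; ring
    · congr 1; ring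
  · refine setLIntegral_congr_fun measurableSet_Ioo fun t ht ↦ ?_
    have h2 := hpos t ht
    rw [← ENNReal.ofReal_pow (by positivity), mul_pow, ← Real.rpow_mul_natCast h2.le]
    congr 3; push_cast; ring

lemma one_sub_norm_le_norm_one_sub_mul {a v : ℂ} (ha : ‖a‖ < 1) :
    1 - ‖v‖ ≤ ‖1 - a * v‖ := by
  have := norm_sub_norm_le (1 : ℂ) (a * v)
  rw [norm_one, norm_mul] at this
  nlinarith [norm_nonneg v]

lemma dilation_weight_le {a v : ℂ} {b p t : ℝ} (ha : ‖a‖ < 1) (hvt : ‖v‖ < t)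
    (ht : t < 1) (ht2 : 1 / 2 < t) :
    (1 - ‖t⁻¹ • v‖) ^ p * ‖1 - a * (t⁻¹ • v)‖ ^ b ≤
      2 ^ |p| * 2 ^ |b| *
        ((t - ‖v‖) ^ (p + min b 0) * (1 - ‖v‖) ^ (-min b 0) * ‖1 - a * v‖ ^ b) := by
  have ht0 : 0 < t := by linarith
  have hn : ‖t⁻¹ • v‖ = ‖v‖ / t := by
    rw [norm_smul, Real.norm_eq_abs, abs_of_pos (inv_pos.2 ht0), div_eq_inv_mul]
  have h0 : 1 - ‖v‖ / t = (t - ‖v‖) / t := by field_simp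
  have hd : 0 < t - ‖v‖ := by linarith
  have hl : t - ‖v‖ ≤ 1 - ‖v‖ / t := by
    rw [h0, le_div_iff₀ ht0]; nlinarith
  have hu : 1 - ‖v‖ / t ≤ 2 * (t - ‖v‖) := by
    rw [h0, div_le_iff₀ ht0]; nlinarith
  have hρ : 0 < 1 - ‖v‖ := by linarith
  have h1 : (1 - ‖t⁻¹ • v‖) ^ p ≤ 2 ^ |p| * (t - ‖v‖) ^ p := by
    rw [hn]
    exact rpow_le_of_comparable p (by norm_num) hd (by linarith) hu (by linarith)
  have hX := one_sub_norm_le_norm_one_sub_mul (v := v) ha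
  have hY := one_sub_norm_le_norm_one_sub_mul (v := t⁻¹ • v) ha
  rw [hn] at hY
  have hXY : ‖(1 - a * v) - (1 - a * (t⁻¹ • v))‖ ≤ 1 - t := by
    have : (1 - a * v) - (1 - a * (t⁻¹ • v)) = (t⁻¹ - 1) • (a * v) := by
      simp only [Complex.real_smul]; push_cast; ring
    have hti : 1 ≤ t⁻¹ := (one_le_inv₀ ht0).2 ht.le
    rw [this, norm_smul, Real.norm_eq_abs, abs_of_nonneg (by linarith), norm_mul]
    have h2 : ‖a‖ * ‖v‖ ≤ t := by nlinarith [norm_nonneg v, norm_nonneg a]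
    calc (t⁻¹ - 1) * (‖a‖ * ‖v‖) ≤ (t⁻¹ - 1) * t := by gcongr
      _ = 1 - t := by field_simp
  have hXY1 := norm_sub_norm_le (1 - a * v) (1 - a * (t⁻¹ • v))
  have hXY2 := norm_sub_norm_le (1 - a * (t⁻¹ • v)) (1 - a * v)
  rw [norm_sub_rev (1 - a * (t⁻¹ • v)) (1 - a * v)] at hXY2
  set X := ‖1 - a * v‖
  set Y := ‖1 - a * (t⁻¹ • v)‖
  have h2 : Y ^ b ≤ 2 ^ |b| * ((t - ‖v‖) ^ min b 0 * (1 - ‖v‖) ^ (-min b 0) * X ^ b) := by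
    rcases le_total 0 b with hb | hb
    · rw [min_eq_right hb, neg_zero, Real.rpow_zero, Real.rpow_zero, one_mul, one_mul,
        abs_of_nonneg hb, ← Real.mul_rpow (by norm_num) (by linarith)]
      exact Real.rpow_le_rpow (by linarith) (by linarith) hb
    · rw [min_eq_left hb, abs_of_nonpos hb, Real.rpow_neg (by norm_num), Real.rpow_neg hρ.le,
        ← div_eq_mul_inv, ← Real.div_rpow hd.le hρ.le,
        ← Real.mul_rpow (div_nonneg hd.le hρ.le) (by linarith), ← div_eq_inv_mul,
        ← Real.div_rpow (mul_nonneg (div_nonneg hd.le hρ.le) (by linarith)) (by norm_num)]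
      have hX0 : 0 < X := by linarith
      refine Real.rpow_le_rpow_of_nonpos (by positivity) ?_ hb
      have : (t - ‖v‖) / (1 - ‖v‖) ≤ 1 := by rw [div_le_one hρ]; linarith
      have h3 : (t - ‖v‖) / (1 - ‖v‖) * (1 - t) ≤ t - ‖v‖ := by
        rw [div_mul_eq_mul_div, div_le_iff₀ hρ]
        nlinarith [norm_nonneg v]
      have h4 : 0 ≤ (t - ‖v‖) / (1 - ‖v‖) := by positivity
      nlinarith
  have hX0 : 0 < X := by linarith
  calc _ ≤ (2 ^ |p| * (t - ‖v‖) ^ p) *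
        (2 ^ |b| * ((t - ‖v‖) ^ min b 0 * (1 - ‖v‖) ^ (-min b 0) * X ^ b)) := by
        gcongr
    _ = _ := by rw [Real.rpow_add hd]; ring

lemma lintegral_dilation_le {a : ℂ} {p b : ℝ} (ha : ‖a‖ < 1) (hγ : -1 < p + min b 0)
    {G : ℂ → ENNReal} (hG : Measurable G) :
    ∫⁻ u in Metric.ball (0:ℂ) 1, ENNReal.ofReal ((1 - ‖u‖) ^ p * ‖1 - a * u‖ ^ b) *
        ∫⁻ t in Set.Ioo (1 / 2 : ℝ) 1, G (t • u) ≤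
      ENNReal.ofReal (4 * (2 ^ |p| * 2 ^ |b| / (p + min b 0 + 1))) *
        ∫⁻ v in Metric.ball (0:ℂ) 1,
          ENNReal.ofReal ((1 - ‖v‖) ^ (p + 1) * ‖1 - a * v‖ ^ b) * G v := by
  set W : ℂ → ENNReal := fun u ↦ ENNReal.ofReal ((1 - ‖u‖) ^ p * ‖1 - a * u‖ ^ b) with hW
  have hWm : Measurable W := by fun_prop
  set m := min b 0 with hm
  set K : ℝ := 2 ^ |p| * 2 ^ |b| with hK
  have hγ' : 0 < p + m + 1 := by linarith
  set Φ : ℝ × ℂ → ENNReal := Set.indicator {q | ‖q.2‖ < q.1} (fun q ↦ W (q.1⁻¹ • q.2) * G q.2)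
    with hΦ
  have hΦm : Measurable Φ := by
    refine Measurable.indicator ?_ (measurableSet_lt (by fun_prop) (by fun_prop))
    fun_prop
  have hscale : ∀ t ∈ Set.Ioo (1 / 2 : ℝ) 1, ∫⁻ u in Metric.ball (0:ℂ) 1, W u * G (t • u) ≤
      ENNReal.ofReal 4 * ∫⁻ v, Φ (t, v) := by
    intro t ht
    have ht0 : 0 < t := by linarith [ht.1]
    have e : ∀ u, (Metric.ball (0:ℂ) 1).indicator (fun u ↦ W u * G (t • u)) u = Φ (t, t • u) := by
      intro u
      by_cases hu : ‖u‖ < 1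
      · rw [Set.indicator_of_mem (by simpa using hu), hΦ, Set.indicator_of_mem]
        · simp only [smul_smul, inv_mul_cancel₀ ht0.ne', one_smul]
        · simpa [abs_of_pos ht0] using mul_lt_of_lt_one_right ht0 hu
      · rw [Set.indicator_of_notMem (by simpa using hu), hΦ, Set.indicator_of_notMem]
        simpa [abs_of_pos ht0] using le_mul_of_one_le_right ht0.le (not_lt.1 hu)
    rw [← lintegral_indicator Metric.isOpen_ball.measurableSet, lintegral_congr e,
      lintegral_comp_real_smul (fun v ↦ Φ (t, v)) ht0]
    gcongr
    rw [inv_le_comm₀ (by positivity) (by norm_num)]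
    nlinarith [ht.1]
  have hinner : ∀ v, ∫⁻ t in Set.Ioo (1 / 2 : ℝ) 1, Φ (t, v) ≤
      (Metric.ball (0:ℂ) 1).indicator (fun v ↦ ENNReal.ofReal (K / (p + m + 1)) *
        (ENNReal.ofReal ((1 - ‖v‖) ^ (p + 1) * ‖1 - a * v‖ ^ b) * G v)) v := by
    intro v
    by_cases hv : ‖v‖ < 1
    · rw [Set.indicator_of_mem (by simpa using hv)]
      have hv0 : 0 < 1 - ‖v‖ := by linarith
      have hpt : ∀ t ∈ Set.Ioo (1 / 2 : ℝ) 1, Φ (t, v) ≤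
          (ENNReal.ofReal (K * (1 - ‖v‖) ^ (-m) * ‖1 - a * v‖ ^ b) * G v) *
            (Set.Ioo ‖v‖ 1).indicator (fun t ↦ ENNReal.ofReal ((t - ‖v‖) ^ (p + m))) t := by
        intro t ht
        by_cases hvt : ‖v‖ < t
        · rw [hΦ, Set.indicator_of_mem (by simpa using hvt),
            Set.indicator_of_mem (show t ∈ Set.Ioo ‖v‖ 1 from ⟨hvt, ht.2⟩),
            mul_right_comm, ← ENNReal.ofReal_mul (by positivity)]
          gcongr
          refine ENNReal.ofReal_le_ofReal ?_
          refine (dilation_weight_le ha hvt ht.2 ht.1).trans_eq ?_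
          ring
        · rw [hΦ, Set.indicator_of_notMem (by simpa using hvt)]
          exact zero_le
      grw [setLIntegral_mono' measurableSet_Ioo hpt, setLIntegral_le_lintegral]
      rw [lintegral_const_mul _ (Measurable.indicator (by fun_prop) measurableSet_Ioo),
        lintegral_indicator measurableSet_Ioo, lintegral_Ioo_sub_rpow hγ hv, mul_right_comm,
        ← ENNReal.ofReal_mul (by positivity), ← mul_assoc (ENNReal.ofReal (K / (p + m + 1))),
        ← ENNReal.ofReal_mul (by positivity)]
      refine le_of_eq ?_
      congr 2
      have hadd : (1 - ‖v‖) ^ (p + 1) = (1 - ‖v‖) ^ (-m) * (1 - ‖v‖) ^ (p + m + 1) := by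
        rw [← Real.rpow_add hv0]
        ring_nf
      rw [hadd]
      generalize (1 - ‖v‖) ^ (p + m + 1) = x
      ring
    · rw [Set.indicator_of_notMem (by simpa using hv)]
      refine le_of_eq ?_
      refine (setLIntegral_congr_fun (g := fun _ ↦ 0) measurableSet_Ioo
        fun t ht ↦ ?_).trans (by simp)
      refine Set.indicator_of_notMem ?_ _
      simp only [Set.mem_ofPred_eq, not_lt]
      linarith [ht.2]
  calc _ = ∫⁻ u in Metric.ball (0:ℂ) 1, ∫⁻ t in Set.Ioo (1 / 2 : ℝ) 1, W u * G (t • u) :=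
        lintegral_congr fun u ↦ (lintegral_const_mul' _ _ ENNReal.ofReal_ne_top).symm
    _ = ∫⁻ t in Set.Ioo (1 / 2 : ℝ) 1, ∫⁻ u in Metric.ball (0:ℂ) 1, W u * G (t • u) :=
        lintegral_lintegral_swap (by fun_prop)
    _ ≤ ∫⁻ t in Set.Ioo (1 / 2 : ℝ) 1, ENNReal.ofReal 4 * ∫⁻ v, Φ (t, v) :=
        setLIntegral_mono' measurableSet_Ioo hscale
    _ = ENNReal.ofReal 4 * ∫⁻ v, ∫⁻ t in Set.Ioo (1 / 2 : ℝ) 1, Φ (t, v) := by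
        rw [lintegral_const_mul' _ _ ENNReal.ofReal_ne_top, lintegral_lintegral_swap]
        exact hΦm.aemeasurable
    _ ≤ ENNReal.ofReal 4 * ∫⁻ v, (Metric.ball (0:ℂ) 1).indicator
        (fun v ↦ ENNReal.ofReal (K / (p + m + 1)) *
        (ENNReal.ofReal ((1 - ‖v‖) ^ (p + 1) * ‖1 - a * v‖ ^ b) * G v)) v := by
        gcongr with v
        exact hinner v
    _ = _ := by
        rw [lintegral_indicator Metric.isOpen_ball.measurableSet,
          lintegral_const_mul' _ _ ENNReal.ofReal_ne_top, ← mul_assoc,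
          ← ENNReal.ofReal_mul (by norm_num)]

lemma exists_lintegral_weight_le {σ τ : ℝ} (hσ : -1 < σ) (hτ : -1 < τ) :
    ∃ C : ENNReal, C ≠ ⊤ ∧ ∀ a : ℂ, ‖a‖ < 1 →
      ∫⁻ u in Metric.ball (0:ℂ) 1,
        ENNReal.ofReal ((1 - ‖u‖) ^ τ * ‖1 - a * u‖ ^ (σ - τ)) ≤ C := by
  have hτi := lintegral_one_sub_norm_rpow_lt_top hτ
  have hσi := lintegral_one_sub_norm_rpow_lt_top hσ
  refine ⟨ENNReal.ofReal (2 ^ |σ - τ|) *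
    ((∫⁻ u in Metric.ball (0:ℂ) 1, ENNReal.ofReal ((1 - ‖u‖) ^ τ)) +
      ∫⁻ u in Metric.ball (0:ℂ) 1, ENNReal.ofReal ((1 - ‖u‖) ^ σ)),
    ENNReal.mul_ne_top ENNReal.ofReal_ne_top (ENNReal.add_ne_top.2 ⟨hτi.ne, hσi.ne⟩), ?_⟩
  intro a ha
  rw [← lintegral_add_left (by fun_prop), ← lintegral_const_mul' _ _ ENNReal.ofReal_ne_top]
  refine setLIntegral_mono' Metric.isOpen_ball.measurableSet fun u hu ↦ ?_
  have hu : 0 < 1 - ‖u‖ := by simpa using hu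
  have h1 := one_sub_norm_le_norm_one_sub_mul (v := u) ha
  have h2 : ‖1 - a * u‖ ≤ 2 := by
    have := norm_sub_le (1 : ℂ) (a * u)
    rw [norm_one, norm_mul] at this
    nlinarith [norm_nonneg u, norm_nonneg a]
  rw [← ENNReal.ofReal_add (by positivity) (by positivity), ← ENNReal.ofReal_mul (by positivity)]
  refine ENNReal.ofReal_le_ofReal ?_
  have hb0 : (1 : ℝ) ≤ 2 ^ |σ - τ| := Real.one_le_rpow (by norm_num) (abs_nonneg _)
  have hp1 : 0 < (1 - ‖u‖) ^ τ := by positivity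
  have hp2 : 0 < (1 - ‖u‖) ^ σ := by positivity
  rcases le_total 0 (σ - τ) with hb | hb
  · have : ‖1 - a * u‖ ^ (σ - τ) ≤ 2 ^ |σ - τ| := by
      rw [abs_of_nonneg hb]
      exact Real.rpow_le_rpow (norm_nonneg _) h2 hb
    nlinarith
  · have : ‖1 - a * u‖ ^ (σ - τ) ≤ (1 - ‖u‖) ^ (σ - τ) :=
      Real.rpow_le_rpow_of_nonpos hu h1 hb
    have h3 : (1 - ‖u‖) ^ τ * (1 - ‖u‖) ^ (σ - τ) = (1 - ‖u‖) ^ σ := by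
      rw [← Real.rpow_add hu]; ring_nf
    nlinarith

lemma exists_ofReal_norm_sq_le_weighted (p b : ℝ) :
    ∃ C : ENNReal, C ≠ ⊤ ∧ ∀ a : ℂ, ‖a‖ < 1 → ∀ h : ℂ → ℂ,
      DifferentiableOn ℂ h (Metric.ball 0 1) → ∀ v : ℂ, ‖v‖ ≤ 1 / 2 →
      ENNReal.ofReal (‖h v‖ ^ 2) ≤ C * ∫⁻ u in Metric.ball (0:ℂ) 1,
        ENNReal.ofReal (‖h u‖ ^ 2 * ((1 - ‖u‖) ^ p * ‖1 - a * u‖ ^ b)) := by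
  set k : ℝ := Real.pi / 2 * (1 / 4) ^ 4 with hk
  have hk0 : 0 < k := by positivity
  refine ⟨ENNReal.ofReal (k⁻¹ * (4 ^ |p| * 4 ^ |b|)), ENNReal.ofReal_ne_top, ?_⟩
  intro a ha h hh v hv
  have hsub : Metric.ball v (1 / 4) ⊆ Metric.ball (0:ℂ) 1 := by
    refine Metric.ball_subset_ball' ?_
    rw [dist_zero_right]; linarith
  have h1 := ofReal_norm_sq_le_lintegral_ball (by norm_num) (hh.mono hsub)
  have h2 : ENNReal.ofReal (‖h v‖ ^ 2) =
      ENNReal.ofReal k⁻¹ * ENNReal.ofReal (‖h v‖ ^ 2 * k) := by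
    rw [← ENNReal.ofReal_mul (by positivity)]
    congr 1; field_simp
  rw [h2, ENNReal.ofReal_mul (p := k⁻¹) (q := 4 ^ |p| * 4 ^ |b|) (by positivity), mul_assoc]
  gcongr
  rw [← lintegral_const_mul' _ _ ENNReal.ofReal_ne_top]
  refine h1.trans (le_trans ?_ (lintegral_mono_set hsub))
  refine setLIntegral_mono' Metric.isOpen_ball.measurableSet fun u hu ↦ ?_
  rw [← ENNReal.ofReal_mul (by positivity)]
  refine ENNReal.ofReal_le_ofReal ?_
  rw [Metric.mem_ball, dist_eq_norm] at hu
  have hu' : ‖u‖ ≤ 3 / 4 := by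
    have := norm_le_norm_add_norm_sub v u
    rw [norm_sub_rev] at this
    linarith
  have h3 := one_sub_norm_le_norm_one_sub_mul (v := u) ha
  have h4 : ‖1 - a * u‖ ≤ 2 := by
    have := norm_sub_le (1 : ℂ) (a * u)
    rw [norm_one, norm_mul] at this
    nlinarith [norm_nonneg u, norm_nonneg a]
  have hx := rpow_le_of_comparable (A := 4) (s := 1 - ‖u‖) (x := 1) p (by norm_num) (by linarith)
    one_pos (by linarith) (by linarith [norm_nonneg u])
  have hy := rpow_le_of_comparable (A := 4) (s := ‖1 - a * u‖) (x := 1) b (by norm_num)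
    (by linarith) one_pos (by linarith) (by linarith)
  rw [Real.one_rpow] at hx hy
  have hxy := mul_le_mul hx hy zero_le_one (by linarith)
  have h5 : ‖u - v‖ ^ 2 ≤ 1 := by nlinarith [norm_nonneg (u - v)]
  calc ‖h u‖ ^ 2 * ‖u - v‖ ^ 2 ≤ ‖h u‖ ^ 2 * (1 * 1) := by gcongr; linarith
    _ ≤ ‖h u‖ ^ 2 * (4 ^ |p| * (1 - ‖u‖) ^ p * (4 ^ |b| * ‖1 - a * u‖ ^ b)) := by gcongr
    _ = _ := by ring

lemma exists_ofReal_norm_sub_sq_le_weighted (p b : ℝ) :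
    ∃ C : ENNReal, C ≠ ⊤ ∧ ∀ a : ℂ, ‖a‖ < 1 → ∀ g : ℂ → ℂ,
      DifferentiableOn ℂ g (Metric.ball 0 1) → ∀ v : ℂ, ‖v‖ ≤ 1 / 2 →
      ENNReal.ofReal (‖g v - g 0‖ ^ 2) ≤ C * ∫⁻ u in Metric.ball (0:ℂ) 1,
        ENNReal.ofReal (‖deriv g u‖ ^ 2 * ((1 - ‖u‖) ^ p * ‖1 - a * u‖ ^ b)) := by
  obtain ⟨C, hC, h⟩ := exists_ofReal_norm_sq_le_weighted p b
  refine ⟨C, hC, fun a ha g hg v hv ↦ ?_⟩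
  set M := C * ∫⁻ u in Metric.ball (0:ℂ) 1,
        ENNReal.ofReal (‖deriv g u‖ ^ 2 * ((1 - ‖u‖) ^ p * ‖1 - a * u‖ ^ b)) with hM
  by_cases hMt : M = ⊤
  · rw [hMt]; exact le_top
  have hb : ∀ x ∈ Metric.closedBall (0:ℂ) (1 / 2), ‖deriv g x‖ ≤ √M.toReal := by
    intro x hx
    have h1 := h a ha (deriv g) (hg.deriv Metric.isOpen_ball) x (by simpa using hx)
    refine Real.le_sqrt_of_sq_le ?_
    exact (ENNReal.ofReal_le_iff_le_toReal hMt).1 h1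
  have hd : ∀ x ∈ Metric.closedBall (0:ℂ) (1 / 2), DifferentiableAt ℂ g x := fun x hx ↦
    hg.differentiableAt (Metric.isOpen_ball.mem_nhds
      (Metric.closedBall_subset_ball (by norm_num) hx))
  have h2 := (convex_closedBall (0:ℂ) (1 / 2)).norm_image_sub_le_of_norm_deriv_le hd hb
    (Metric.mem_closedBall_self (by norm_num))
    (show v ∈ Metric.closedBall (0:ℂ) (1 / 2) by simpa using hv)
  rw [ENNReal.ofReal_le_iff_le_toReal hMt]
  rw [sub_zero] at h2
  calc ‖g v - g 0‖ ^ 2 ≤ (√M.toReal * 1) ^ 2 := by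
        gcongr
        exact h2.trans (by gcongr; linarith)
    _ = M.toReal := by rw [mul_one, Real.sq_sqrt ENNReal.toReal_nonneg]

lemma exists_lintegral_norm_sub_half_sq_le {σ τ : ℝ} (hσ : -1 < σ) (hτ : -1 < τ) :
    ∃ C : ENNReal, C ≠ ⊤ ∧ ∀ a : ℂ, ‖a‖ < 1 → ∀ g : ℂ → ℂ,
      DifferentiableOn ℂ g (Metric.ball 0 1) →
      ∫⁻ u in Metric.ball (0:ℂ) 1, ENNReal.ofReal
          (‖g u - g ((1 / 2 : ℝ) • u)‖ ^ 2 * ((1 - ‖u‖) ^ τ * ‖1 - a * u‖ ^ (σ - τ))) ≤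
        C * ∫⁻ u in Metric.ball (0:ℂ) 1,
          ENNReal.ofReal (‖deriv g u‖ ^ 2 * ((1 - ‖u‖) ^ (τ + 2) * ‖1 - a * u‖ ^ (σ - τ))) := by
  set ε : ℝ := (min σ τ + 1) / 2 with hε
  have hmin : -1 < min σ τ := lt_min hσ hτ
  have hε0 : 0 < ε := by linarith
  have hγ : -1 < (τ - ε) + min (σ - τ) 0 := by
    have : min (σ - τ) 0 = min σ τ - τ := by rw [← min_sub_sub_right, sub_self]
    rw [this]; linarith
  refine ⟨ENNReal.ofReal ε⁻¹ * ENNReal.ofReal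
    (4 * (2 ^ |τ - ε| * 2 ^ |σ - τ| / (τ - ε + min (σ - τ) 0 + 1))),
    ENNReal.mul_ne_top ENNReal.ofReal_ne_top ENNReal.ofReal_ne_top, fun a ha g hg ↦ ?_⟩
  have hGm : Measurable fun v ↦ ENNReal.ofReal (‖deriv g v‖ ^ 2 * (1 - ‖v‖) ^ (1 + ε)) := by
    have := measurable_deriv g
    fun_prop
  have hdil := lintegral_dilation_le (p := τ - ε) ha hγ hGm
  calc _ ≤ ∫⁻ u in Metric.ball (0:ℂ) 1, ENNReal.ofReal ε⁻¹ *
          (ENNReal.ofReal ((1 - ‖u‖) ^ (τ - ε) * ‖1 - a * u‖ ^ (σ - τ)) *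
            ∫⁻ t in Set.Ioo (1 / 2 : ℝ) 1,
              ENNReal.ofReal (‖deriv g (t • u)‖ ^ 2 * (1 - ‖t • u‖) ^ (1 + ε))) := by
        refine setLIntegral_mono' Metric.isOpen_ball.measurableSet fun u hu ↦ ?_
        have hu : ‖u‖ < 1 := by simpa using hu
        have hu0 : 0 < 1 - ‖u‖ := by linarith
        have h1 := ofReal_norm_sub_half_sq_le hg hε0 hu
        rw [ENNReal.ofReal_mul (by positivity)]
        grw [h1]
        rw [mul_right_comm, ← ENNReal.ofReal_mul (by positivity),
          ← mul_assoc (ENNReal.ofReal ε⁻¹), ← ENNReal.ofReal_mul (by positivity),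
          sub_eq_add_neg τ ε, Real.rpow_add hu0]
        refine le_of_eq ?_
        congr 2
        ring
    _ ≤ ENNReal.ofReal ε⁻¹ * (_ * _) := by
        rw [lintegral_const_mul' _ _ ENNReal.ofReal_ne_top]
        exact mul_le_mul_right hdil _
    _ = _ := by
        rw [← mul_assoc]
        congr 1
        refine setLIntegral_congr_fun Metric.isOpen_ball.measurableSet fun u hu ↦ ?_
        have hu : 0 < 1 - ‖u‖ := by simpa using hu
        have hadd : (1 - ‖u‖) ^ (τ + 2) = (1 - ‖u‖) ^ (τ - ε + 1) * (1 - ‖u‖) ^ (1 + ε) := by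
          rw [← Real.rpow_add hu]
          ring_nf
        rw [← ENNReal.ofReal_mul (by positivity), hadd]
        congr 1
        ring

lemma exists_lintegral_norm_sub_sq_le {σ τ : ℝ} (hσ : -1 < σ) (hτ : -1 < τ) :
    ∃ C : ENNReal, C ≠ ⊤ ∧ ∀ a : ℂ, ‖a‖ < 1 → ∀ g : ℂ → ℂ,
      DifferentiableOn ℂ g (Metric.ball 0 1) →
      ∫⁻ u in Metric.ball (0:ℂ) 1, ENNReal.ofReal
          (‖g u - g 0‖ ^ 2 * ((1 - ‖u‖) ^ τ * ‖1 - a * u‖ ^ (σ - τ))) ≤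
        C * ∫⁻ u in Metric.ball (0:ℂ) 1,
          ENNReal.ofReal (‖deriv g u‖ ^ 2 * ((1 - ‖u‖) ^ (τ + 2) * ‖1 - a * u‖ ^ (σ - τ))) := by
  obtain ⟨C₁, hC₁, h₁⟩ := exists_lintegral_norm_sub_half_sq_le hσ hτ
  obtain ⟨C₂, hC₂, h₂⟩ := exists_ofReal_norm_sub_sq_le_weighted (τ + 2) (σ - τ)
  obtain ⟨C₃, hC₃, h₃⟩ := exists_lintegral_weight_le hσ hτ
  refine ⟨2 * (C₁ + C₂ * C₃), by finiteness, fun a ha g hg ↦ ?_⟩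
  set I := ∫⁻ u in Metric.ball (0:ℂ) 1,
    ENNReal.ofReal (‖deriv g u‖ ^ 2 * ((1 - ‖u‖) ^ (τ + 2) * ‖1 - a * u‖ ^ (σ - τ))) with hI
  calc _ ≤ ∫⁻ u in Metric.ball (0:ℂ) 1, 2 * (ENNReal.ofReal
          (‖g u - g ((1 / 2 : ℝ) • u)‖ ^ 2 * ((1 - ‖u‖) ^ τ * ‖1 - a * u‖ ^ (σ - τ))) +
          C₂ * I * ENNReal.ofReal ((1 - ‖u‖) ^ τ * ‖1 - a * u‖ ^ (σ - τ))) := by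
        refine setLIntegral_mono' Metric.isOpen_ball.measurableSet fun u hu ↦ ?_
        have hu : ‖u‖ < 1 := by simpa using hu
        have hu0 : 0 < 1 - ‖u‖ := by linarith
        have hw : 0 ≤ (1 - ‖u‖) ^ τ * ‖1 - a * u‖ ^ (σ - τ) := by positivity
        have h4 := h₂ a ha g hg ((1 / 2 : ℝ) • u) (by rw [norm_smul]; norm_num; linarith)
        rw [ENNReal.ofReal_mul (p := ‖g u - g 0‖ ^ 2) (by positivity),
          ENNReal.ofReal_mul (p := ‖g u - g ((1 / 2 : ℝ) • u)‖ ^ 2) (by positivity), ← add_mul,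
          ← mul_assoc]
        gcongr
        grw [← h4]
        rw [← ENNReal.ofReal_add (by positivity) (by positivity),
          show (2 : ENNReal) = ENNReal.ofReal 2 by simp, ← ENNReal.ofReal_mul (by norm_num)]
        refine ENNReal.ofReal_le_ofReal ?_
        set v := (1 / 2 : ℝ) • u
        have h5 : ‖g u - g 0‖ ≤ ‖g u - g v‖ + ‖g v - g 0‖ := norm_sub_le_norm_sub_add_norm_sub ..
        nlinarith [norm_nonneg (g u - g 0), sq_nonneg (‖g u - g v‖ - ‖g v - g 0‖)]
    _ = 2 * ((∫⁻ u in Metric.ball (0:ℂ) 1, ENNReal.ofReal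
          (‖g u - g ((1 / 2 : ℝ) • u)‖ ^ 2 * ((1 - ‖u‖) ^ τ * ‖1 - a * u‖ ^ (σ - τ)))) +
          C₂ * I * ∫⁻ u in Metric.ball (0:ℂ) 1,
            ENNReal.ofReal ((1 - ‖u‖) ^ τ * ‖1 - a * u‖ ^ (σ - τ))) := by
        rw [lintegral_const_mul' _ _ (by simp), lintegral_add_right _ (by fun_prop),
          lintegral_const_mul _ (by fun_prop)]
    _ ≤ 2 * (C₁ * I + C₂ * I * C₃) := by
        gcongr
        · exact h₁ a ha g hg
        · exact h₃ a ha
    _ = _ := by ring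

lemma exists_lintegral_norm_sub_sq_le_of_one_sub_sq {σ τ : ℝ} (hσ : -1 < σ) (hτ : -1 < τ) :
    ∃ C : ENNReal, C ≠ ⊤ ∧ ∀ a : ℂ, ‖a‖ < 1 → ∀ g : ℂ → ℂ,
      DifferentiableOn ℂ g (Metric.ball 0 1) →
      ∫⁻ u in Metric.ball (0:ℂ) 1, ENNReal.ofReal
          (‖g u - g 0‖ ^ 2 * ((1 - ‖u‖ ^ 2) ^ τ * ‖1 - a * u‖ ^ (σ - τ))) ≤
        C * ∫⁻ u in Metric.ball (0:ℂ) 1,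
          ENNReal.ofReal (‖deriv g u‖ ^ 2 *
            ((1 - ‖u‖ ^ 2) ^ (τ + 2) * ‖1 - a * u‖ ^ (σ - τ))) := by
  obtain ⟨C, hC, h⟩ := exists_lintegral_norm_sub_sq_le hσ hτ
  refine ⟨ENNReal.ofReal (2 ^ |τ|) * (C * ENNReal.ofReal (2 ^ |τ + 2|)), by finiteness,
    fun a ha g hg ↦ ?_⟩
  rw [mul_assoc, mul_assoc, ← lintegral_const_mul' _ _ ENNReal.ofReal_ne_top]
  have key : ∀ u ∈ Metric.ball (0:ℂ) 1, 0 < 1 - ‖u‖ ∧ 1 - ‖u‖ ^ 2 ≤ 2 * (1 - ‖u‖) ∧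
      1 - ‖u‖ ≤ 1 - ‖u‖ ^ 2 := by
    intro u hu
    have hu : ‖u‖ < 1 := by simpa using hu
    refine ⟨?_, ?_, ?_⟩ <;> nlinarith [norm_nonneg u]
  calc _ ≤ ENNReal.ofReal (2 ^ |τ|) * ∫⁻ u in Metric.ball (0:ℂ) 1, ENNReal.ofReal
          (‖g u - g 0‖ ^ 2 * ((1 - ‖u‖) ^ τ * ‖1 - a * u‖ ^ (σ - τ))) := by
        rw [← lintegral_const_mul' _ _ ENNReal.ofReal_ne_top]
        refine setLIntegral_mono' Metric.isOpen_ball.measurableSet fun u hu ↦ ?_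
        obtain ⟨k1, k2, k3⟩ := key u hu
        rw [← ENNReal.ofReal_mul (by positivity)]
        refine ENNReal.ofReal_le_ofReal ?_
        have := rpow_le_of_comparable (A := 2) τ (by norm_num) k1 (by linarith) k2 (by linarith)
        calc _ ≤ ‖g u - g 0‖ ^ 2 * (2 ^ |τ| * (1 - ‖u‖) ^ τ * ‖1 - a * u‖ ^ (σ - τ)) := by gcongr
          _ = _ := by ring
    _ ≤ ENNReal.ofReal (2 ^ |τ|) * (C * ∫⁻ u in Metric.ball (0:ℂ) 1, ENNReal.ofReal
          (‖deriv g u‖ ^ 2 * ((1 - ‖u‖) ^ (τ + 2) * ‖1 - a * u‖ ^ (σ - τ)))) := by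
        gcongr
        exact h a ha g hg
    _ ≤ _ := by
        gcongr ENNReal.ofReal (2 ^ |τ|) * (C * ?_)
        refine setLIntegral_mono' Metric.isOpen_ball.measurableSet fun u hu ↦ ?_
        obtain ⟨k1, k2, k3⟩ := key u hu
        rw [← ENNReal.ofReal_mul (by positivity)]
        refine ENNReal.ofReal_le_ofReal ?_
        have := rpow_le_of_comparable (A := 2) (x := 1 - ‖u‖) (s := 1 - ‖u‖ ^ 2) (τ + 2)
          (by norm_num) (by linarith) (by linarith) (by linarith) k2
        calc _ ≤ ‖deriv g u‖ ^ 2 *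
              (2 ^ |τ + 2| * (1 - ‖u‖ ^ 2) ^ (τ + 2) * ‖1 - a * u‖ ^ (σ - τ)) := by gcongr
          _ = _ := by ring

/-- The involutive disc automorphism exchanging `0` and `z`. -/
def discInvolution (z u : ℂ) : ℂ := (z - u) / (1 - (starRingEnd ℂ) z * u)

lemma one_sub_conj_mul_ne_zero {z u : ℂ} (hz : ‖z‖ < 1) (hu : ‖u‖ < 1) :
    1 - (starRingEnd ℂ) z * u ≠ 0 := by
  have := one_sub_norm_le_left (z := z) hu
  exact norm_pos_iff.1 (by linarith)

lemma one_sub_conj_mul_discInvolution {z u : ℂ} (hz : ‖z‖ < 1) (hu : ‖u‖ < 1) :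
    1 - (starRingEnd ℂ) z * discInvolution z u =
      ((1 - ‖z‖ ^ 2 : ℝ) : ℂ) / (1 - (starRingEnd ℂ) z * u) := by
  have h := one_sub_conj_mul_ne_zero hz hu
  rw [discInvolution, eq_div_iff h, sub_mul, mul_div_assoc', div_mul_cancel₀ _ h]
  push_cast
  rw [← Complex.conj_mul']
  ring

lemma norm_one_sub_conj_mul_discInvolution {z u : ℂ} (hz : ‖z‖ < 1) (hu : ‖u‖ < 1) :
    ‖1 - (starRingEnd ℂ) z * discInvolution z u‖ =
      (1 - ‖z‖ ^ 2) / ‖1 - (starRingEnd ℂ) z * u‖ := by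
  rw [one_sub_conj_mul_discInvolution hz hu, norm_div, Complex.norm_real, Real.norm_of_nonneg]
  nlinarith [norm_nonneg z]

lemma one_sub_norm_discInvolution_sq {z u : ℂ} (hz : ‖z‖ < 1) (hu : ‖u‖ < 1) :
    1 - ‖discInvolution z u‖ ^ 2 =
      (1 - ‖z‖ ^ 2) * (1 - ‖u‖ ^ 2) / ‖1 - (starRingEnd ℂ) z * u‖ ^ 2 := by
  have h := norm_pos_iff.2 (one_sub_conj_mul_ne_zero hz hu)
  rw [discInvolution, norm_div, div_pow, eq_div_iff (by positivity), sub_mul,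
    div_mul_cancel₀ _ (by positivity), norm_one_sub_conj_mul_sq]
  ring

lemma norm_discInvolution_lt_one {z u : ℂ} (hz : ‖z‖ < 1) (hu : ‖u‖ < 1) :
    ‖discInvolution z u‖ < 1 := by
  have h := norm_pos_iff.2 (one_sub_conj_mul_ne_zero hz hu)
  have h1 : 0 < 1 - ‖z‖ ^ 2 := by nlinarith [norm_nonneg z]
  have h2 : 0 < 1 - ‖u‖ ^ 2 := by nlinarith [norm_nonneg u]
  have h3 : 0 < 1 - ‖discInvolution z u‖ ^ 2 := by
    rw [one_sub_norm_discInvolution_sq hz hu]; positivity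
  nlinarith [norm_nonneg (discInvolution z u)]

lemma discInvolution_discInvolution {z u : ℂ} (hz : ‖z‖ < 1) (hu : ‖u‖ < 1) :
    discInvolution z (discInvolution z u) = u := by
  have h := one_sub_conj_mul_ne_zero hz hu
  have h1 : ((1 - ‖z‖ ^ 2 : ℝ) : ℂ) ≠ 0 := by
    norm_cast
    nlinarith [norm_nonneg z]
  rw [discInvolution, one_sub_conj_mul_discInvolution hz hu, div_div_eq_mul_div, div_eq_iff h1,
    discInvolution, sub_mul, div_mul_cancel₀ _ h]
  push_cast
  rw [← Complex.conj_mul']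
  ring

lemma hasDerivAt_discInvolution {z u : ℂ} (hz : ‖z‖ < 1) (hu : ‖u‖ < 1) :
    HasDerivAt (discInvolution z)
      (-((1 - ‖z‖ ^ 2 : ℝ) : ℂ) / (1 - (starRingEnd ℂ) z * u) ^ 2) u := by
  have h1 := (hasDerivAt_id u).const_sub z
  have h2 := ((hasDerivAt_id u).const_mul ((starRingEnd ℂ) z)).const_sub 1
  refine (h1.div h2 (one_sub_conj_mul_ne_zero hz hu)).congr_deriv ?_
  push_cast
  rw [← Complex.conj_mul', id]
  ring

lemma image_discInvolution_ball {z : ℂ} (hz : ‖z‖ < 1) :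
    discInvolution z '' Metric.ball 0 1 = Metric.ball 0 1 := by
  ext w
  simp only [Set.mem_image, mem_ball_zero_iff]
  refine ⟨?_, fun hw ↦ ⟨_, norm_discInvolution_lt_one hz hw, discInvolution_discInvolution hz hw⟩⟩
  rintro ⟨u, hu, rfl⟩
  exact norm_discInvolution_lt_one hz hu

lemma lintegral_image_eq_lintegral_norm_deriv_sq_mul {s : Set ℂ} {φ φ' : ℂ → ℂ}
    (hs : MeasurableSet s) (hφ' : ∀ x ∈ s, HasDerivAt φ (φ' x) x) (hφ : Set.InjOn φ s)
    (F : ℂ → ENNReal) :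
    ∫⁻ w in φ '' s, F w = ∫⁻ u in s, ENNReal.ofReal (‖φ' u‖ ^ 2) * F (φ u) := by
  rw [lintegral_image_eq_lintegral_abs_det_fderiv_mul volume hs
    (fun x hx ↦ ((hφ' x hx).hasFDerivAt.restrictScalars ℝ).hasFDerivWithinAt) hφ]
  simp [ContinuousLinearMap.det, LinearMap.det_restrictScalars,
    Algebra.norm_complex_eq, Complex.normSq_eq_norm_sq]

lemma lintegral_ball_comp_discInvolution {z : ℂ} (hz : ‖z‖ < 1) (F : ℂ → ENNReal) :
    ∫⁻ w in Metric.ball (0:ℂ) 1, F w = ∫⁻ u in Metric.ball (0:ℂ) 1,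
      ENNReal.ofReal (((1 - ‖z‖ ^ 2) / ‖1 - (starRingEnd ℂ) z * u‖ ^ 2) ^ 2) *
        F (discInvolution z u) := by
  have hinj : Set.InjOn (discInvolution z) (Metric.ball 0 1) := by
    intro u hu v hv huv
    rw [← discInvolution_discInvolution hz (mem_ball_zero_iff.1 hu), huv,
      discInvolution_discInvolution hz (mem_ball_zero_iff.1 hv)]
  have h := lintegral_image_eq_lintegral_norm_deriv_sq_mul Metric.isOpen_ball.measurableSet
    (fun u hu ↦ hasDerivAt_discInvolution hz (mem_ball_zero_iff.1 hu)) hinj F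
  rw [image_discInvolution_ball hz] at h
  rw [h]
  congr! 5 with u
  rw [norm_div, norm_neg, Complex.norm_real, norm_pow, Real.norm_of_nonneg]
  nlinarith [norm_nonneg z]

lemma rpow_div_rpow_scaling {s x d : ℝ} (hs : 0 < s) (hx : 0 < x) (hd : 0 < d) (q r : ℝ) :
    (s * x / d ^ 2) ^ q / (s / d) ^ r = s ^ (q - r) * (x ^ q * d ^ (r - 2 * q)) := by
  rw [Real.div_rpow (by positivity) (by positivity), Real.mul_rpow hs.le hx.le,
    Real.div_rpow hs.le hd.le, ← Real.rpow_natCast d 2, ← Real.rpow_mul hd.le,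
    Real.rpow_sub hs, Real.rpow_sub hd]
  push_cast
  have := Real.rpow_pos_of_pos hs r
  have := Real.rpow_pos_of_pos hd r
  have := Real.rpow_pos_of_pos hd (2 * q)
  field_simp

lemma exists_lintegral_norm_sub_sq_div_le {σ τ : ℝ} (hσ : -1 < σ) (hτ : -1 < τ) :
    ∃ C : ENNReal, C ≠ ⊤ ∧ ∀ f : ℂ → ℂ, DifferentiableOn ℂ f (Metric.ball 0 1) →
      ∀ z : ℂ, ‖z‖ < 1 →
      ∫⁻ w in Metric.ball (0:ℂ) 1, ENNReal.ofReal (‖f z - f w‖ ^ 2 *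
          ((1 - ‖w‖ ^ 2) ^ τ / ‖1 - (starRingEnd ℂ) z * w‖ ^ (4 + σ + τ))) ≤
        C * ∫⁻ w in Metric.ball (0:ℂ) 1, ENNReal.ofReal (‖deriv f w‖ ^ 2 *
          ((1 - ‖w‖ ^ 2) ^ (2 + τ) / ‖1 - (starRingEnd ℂ) z * w‖ ^ (4 + σ + τ))) := by
  obtain ⟨C, hC, h⟩ := exists_lintegral_norm_sub_sq_le_of_one_sub_sq hσ hτ
  refine ⟨C, hC, fun f hf z hz ↦ ?_⟩
  have hs : 0 < 1 - ‖z‖ ^ 2 := by nlinarith [norm_nonneg z]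
  have hg : DifferentiableOn ℂ (f ∘ discInvolution z) (Metric.ball 0 1) := by
    refine hf.comp (fun u hu ↦ ?_) fun u hu ↦ ?_
    · exact (hasDerivAt_discInvolution hz
        (by simpa using hu)).differentiableAt.differentiableWithinAt
    · simpa using norm_discInvolution_lt_one hz (by simpa using hu)
  have key := h ((starRingEnd ℂ) z) (by simpa using hz) _ hg
  have h0 : discInvolution z 0 = z := by simp [discInvolution]
  rw [lintegral_ball_comp_discInvolution hz, lintegral_ball_comp_discInvolution hz (fun w ↦
    ENNReal.ofReal (‖deriv f w‖ ^ 2 * _))]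
  have e1 : ∀ u ∈ Metric.ball (0:ℂ) 1,
      ENNReal.ofReal (((1 - ‖z‖ ^ 2) / ‖1 - (starRingEnd ℂ) z * u‖ ^ 2) ^ 2) *
      ENNReal.ofReal (‖f z - f (discInvolution z u)‖ ^ 2 * ((1 - ‖discInvolution z u‖ ^ 2) ^ τ /
        ‖1 - (starRingEnd ℂ) z * discInvolution z u‖ ^ (4 + σ + τ))) =
      ENNReal.ofReal ((1 - ‖z‖ ^ 2) ^ (-2 - σ)) * ENNReal.ofReal
        (‖(f ∘ discInvolution z) u - (f ∘ discInvolution z) 0‖ ^ 2 *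
          ((1 - ‖u‖ ^ 2) ^ τ * ‖1 - (starRingEnd ℂ) z * u‖ ^ (σ - τ))) := by
    intro u hu
    have hu : ‖u‖ < 1 := by simpa using hu
    have hx : 0 < 1 - ‖u‖ ^ 2 := by nlinarith [norm_nonneg u]
    have hd := norm_pos_iff.2 (one_sub_conj_mul_ne_zero hz hu)
    rw [← ENNReal.ofReal_mul (by positivity), ← ENNReal.ofReal_mul (by positivity),
      norm_one_sub_conj_mul_discInvolution hz hu, one_sub_norm_discInvolution_sq hz hu,
      rpow_div_rpow_scaling hs hx hd, Function.comp, Function.comp, h0,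
      norm_sub_rev (f (discInvolution z u))]
    generalize ‖1 - (starRingEnd ℂ) z * u‖ = d at *
    generalize 1 - ‖z‖ ^ 2 = s at *
    have hs2 : s ^ (-2 - σ) = s ^ (τ - (4 + σ + τ)) * s ^ 2 := by
      rw [← Real.rpow_add_natCast hs.ne']; push_cast; ring_nf
    have hd2 : d ^ (4 + σ + τ - 2 * τ) = d ^ (σ - τ) * d ^ 4 := by
      rw [← Real.rpow_add_natCast hd.ne']; push_cast; ring_nf
    rw [hs2, hd2]
    congr 1
    field_simp
  have e2 : ∀ u ∈ Metric.ball (0:ℂ) 1,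
      ENNReal.ofReal (((1 - ‖z‖ ^ 2) / ‖1 - (starRingEnd ℂ) z * u‖ ^ 2) ^ 2) *
      ENNReal.ofReal (‖deriv f (discInvolution z u)‖ ^ 2 *
        ((1 - ‖discInvolution z u‖ ^ 2) ^ (2 + τ) /
          ‖1 - (starRingEnd ℂ) z * discInvolution z u‖ ^ (4 + σ + τ))) =
      ENNReal.ofReal ((1 - ‖z‖ ^ 2) ^ (-2 - σ)) * ENNReal.ofReal
        (‖deriv (f ∘ discInvolution z) u‖ ^ 2 *
          ((1 - ‖u‖ ^ 2) ^ (τ + 2) * ‖1 - (starRingEnd ℂ) z * u‖ ^ (σ - τ))) := by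
    intro u hu
    have hu : ‖u‖ < 1 := by simpa using hu
    have hx : 0 < 1 - ‖u‖ ^ 2 := by nlinarith [norm_nonneg u]
    have hd := norm_pos_iff.2 (one_sub_conj_mul_ne_zero hz hu)
    have hφ := hasDerivAt_discInvolution hz hu
    have hdf : DifferentiableAt ℂ f (discInvolution z u) := hf.differentiableAt
      (Metric.isOpen_ball.mem_nhds (by simpa using norm_discInvolution_lt_one hz hu))
    rw [← ENNReal.ofReal_mul (by positivity), ← ENNReal.ofReal_mul (by positivity),
      norm_one_sub_conj_mul_discInvolution hz hu, one_sub_norm_discInvolution_sq hz hu,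
      rpow_div_rpow_scaling hs hx hd, (hdf.hasDerivAt.comp u hφ).deriv, norm_mul, norm_div,
      norm_neg, Complex.norm_real, norm_pow, Real.norm_of_nonneg hs.le, add_comm τ 2,
      show 2 + τ - (4 + σ + τ) = -2 - σ by ring, show 4 + σ + τ - 2 * (2 + τ) = σ - τ by ring]
    congr 1
    ring
  rw [setLIntegral_congr_fun Metric.isOpen_ball.measurableSet e1,
    setLIntegral_congr_fun Metric.isOpen_ball.measurableSet e2,
    lintegral_const_mul' _ _ ENNReal.ofReal_ne_top, lintegral_const_mul' _ _ ENNReal.ofReal_ne_top,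
    mul_left_comm]
  gcongr

lemma exists_ofReal_norm_deriv_sq_le (σ τ : ℝ) :
    ∃ C : ENNReal, C ≠ ⊤ ∧ ∀ f : ℂ → ℂ, DifferentiableOn ℂ f (Metric.ball 0 1) →
      ∀ z : ℂ, ‖z‖ < 1 →
      ENNReal.ofReal (‖deriv f z‖ ^ 2) ≤ C * (ENNReal.ofReal ((1 - ‖z‖ ^ 2) ^ σ) *
        ∫⁻ w in Metric.ball (0:ℂ) 1, ENNReal.ofReal (‖f z - f w‖ ^ 2 *
          ((1 - ‖w‖ ^ 2) ^ τ / ‖1 - (starRingEnd ℂ) z * w‖ ^ (4 + σ + τ)))) := by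
  set k : ℝ := Real.pi / 2 * (1 / 2) ^ 4 with hk
  have hk0 : 0 < k := by positivity
  refine ⟨ENNReal.ofReal (k⁻¹ * (8 ^ |σ| * 8 ^ |τ| * 8 ^ |-(4 + σ + τ)|)), ENNReal.ofReal_ne_top,
    fun f hf z hz ↦ ?_⟩
  set s := 1 - ‖z‖ with hs
  have hs0 : 0 < s := by linarith
  have hz2 : 0 < 1 - ‖z‖ ^ 2 := by nlinarith [norm_nonneg z]
  have hsub : Metric.ball z (s / 2) ⊆ Metric.ball (0:ℂ) 1 := by
    refine Metric.ball_subset_ball' ?_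
    rw [dist_zero_right]; linarith
  have hdiff : DifferentiableOn ℂ (dslope f z) (Metric.ball z (s / 2)) :=
    (Complex.differentiableOn_dslope (Metric.ball_mem_nhds z (by positivity))).2 (hf.mono hsub)
  have h1 := ofReal_norm_sq_le_lintegral_ball (by positivity) hdiff
  rw [dslope_same] at h1
  have h2 : ENNReal.ofReal (‖deriv f z‖ ^ 2) = ENNReal.ofReal (k * s ^ 4)⁻¹ *
      ENNReal.ofReal (‖deriv f z‖ ^ 2 * (Real.pi / 2 * (s / 2) ^ 4)) := by
    rw [← ENNReal.ofReal_mul (by positivity)]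
    congr 1
    rw [hk]
    field_simp
  rw [h2]
  grw [h1]
  rw [← lintegral_const_mul' _ _ ENNReal.ofReal_ne_top,
    ← lintegral_const_mul' _ _ ENNReal.ofReal_ne_top,
    ← lintegral_const_mul' _ _ ENNReal.ofReal_ne_top]
  refine le_trans ?_ (lintegral_mono_set hsub)
  refine setLIntegral_mono' Metric.isOpen_ball.measurableSet fun w hw ↦ ?_
  have hw1 : ‖w‖ < 1 := by simpa using hsub hw
  have hw2 : 0 < 1 - ‖w‖ ^ 2 := by nlinarith [norm_nonneg w]
  rw [Metric.mem_ball, dist_eq_norm] at hw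
  have hwz : ‖w‖ ≤ ‖z‖ + s / 2 := by linarith [norm_sub_norm_le w z]
  have hzw : ‖z‖ ≤ ‖w‖ + s / 2 := by
    rw [norm_sub_rev] at hw
    linarith [norm_sub_norm_le z w]
  have hd := one_sub_norm_le_left (z := z) hw1
  have hd' : ‖1 - (starRingEnd ℂ) z * w‖ ≤ 8 * s := by
    have h3 := norm_one_sub_conj_mul_sq z w
    rw [norm_sub_rev z w] at h3
    refine (sq_le_sq₀ (norm_nonneg _) (by positivity)).1 ?_
    have h4 : ‖w - z‖ ^ 2 ≤ (s / 2) ^ 2 := by gcongr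
    have h5 : (1 - ‖z‖ ^ 2) * (1 - ‖w‖ ^ 2) ≤ (2 * s) * (4 * s) := by
      gcongr <;> nlinarith [norm_nonneg z, norm_nonneg w]
    nlinarith
  have hdpos : 0 < ‖1 - (starRingEnd ℂ) z * w‖ := by linarith
  have b1 := rpow_le_of_comparable (A := 8) (x := s) (s := 1 - ‖z‖ ^ 2) σ (by norm_num) hz2 hs0
    (by nlinarith [norm_nonneg z]) (by nlinarith [norm_nonneg z])
  have b2 := rpow_le_of_comparable (A := 8) (x := s) (s := 1 - ‖w‖ ^ 2) τ (by norm_num) hw2 hs0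
    (by nlinarith [norm_nonneg w]) (by nlinarith [norm_nonneg w])
  have b3 := rpow_le_of_comparable (A := 8) (x := s) (s := ‖1 - (starRingEnd ℂ) z * w‖)
    (-(4 + σ + τ)) (by norm_num) hdpos hs0 (by linarith) hd'
  have hs4 : (s ^ 4)⁻¹ = s ^ σ * s ^ τ * s ^ (-(4 + σ + τ)) := by
    rw [← Real.rpow_add hs0, ← Real.rpow_add hs0, ← Real.rpow_natCast, ← Real.rpow_neg hs0.le]
    congr 1
    push_cast
    ring
  have hf' : ‖dslope f z w‖ ^ 2 * ‖w - z‖ ^ 2 = ‖f z - f w‖ ^ 2 := by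
    rw [← mul_pow, mul_comm, ← norm_mul, ← smul_eq_mul, sub_smul_dslope, norm_sub_rev]
  rw [hf', ← ENNReal.ofReal_mul (by positivity), ← ENNReal.ofReal_mul (by positivity),
    ← ENNReal.ofReal_mul (by positivity), mul_inv, hs4]
  refine ENNReal.ofReal_le_ofReal ?_
  rw [Real.rpow_neg hdpos.le] at b3
  calc _ ≤ k⁻¹ * (8 ^ |σ| * (1 - ‖z‖ ^ 2) ^ σ * (8 ^ |τ| * (1 - ‖w‖ ^ 2) ^ τ) *
        (8 ^ |-(4 + σ + τ)| * (‖1 - (starRingEnd ℂ) z * w‖ ^ (4 + σ + τ))⁻¹)) *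
          ‖f z - f w‖ ^ 2 := by gcongr
    _ = _ := by ring

lemma ofReal_poissonInt {μ : Measure ℂ} [IsFiniteMeasure μ]
    (hμ : μ ((Metric.sphere (0:ℂ) 1)ᶜ) = 0) {z : ℂ} (hz : ‖z‖ < 1) :
    ENNReal.ofReal (poissonInt μ z) = ENNReal.ofReal (2 * Real.pi)⁻¹ *
      ∫⁻ ζ, ENNReal.ofReal ((1 - ‖z‖ ^ 2) / ‖ζ - z‖ ^ 2) ∂μ := by
  have hz2 : 0 < 1 - ‖z‖ ^ 2 := by nlinarith [norm_nonneg z]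
  have hz1 : 0 < 1 - ‖z‖ := by linarith
  rw [poissonInt, ENNReal.ofReal_mul (by positivity), ofReal_integral_eq_lintegral_ofReal]
  · refine Integrable.of_bound (C := (1 - ‖z‖ ^ 2) / (1 - ‖z‖) ^ 2)
      (Measurable.aestronglyMeasurable (by fun_prop)) ?_
    filter_upwards [measure_eq_zero_iff_ae_notMem.1 hμ] with ζ hζ
    have hζ : ‖ζ‖ = 1 := by simpa using hζ
    rw [Real.norm_of_nonneg (by positivity)]
    gcongr
    have := norm_sub_norm_le ζ z
    rwa [hζ] at this
  · exact Filter.Eventually.of_forall fun ζ ↦ by positivity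

lemma measurable_poissonInt (μ : Measure ℂ) [IsFiniteMeasure μ] : Measurable (poissonInt μ) := by
  unfold poissonInt
  refine Measurable.const_mul ?_ _
  refine StronglyMeasurable.measurable ?_
  exact StronglyMeasurable.integral_prod_right (ν := μ)
    (f := fun z ζ : ℂ ↦ (1 - ‖z‖ ^ 2) / ‖ζ - z‖ ^ 2)
    (Measurable.stronglyMeasurable (by unfold Function.uncurry; fun_prop))

lemma poissonInt_nonneg (μ : Measure ℂ) {z : ℂ} (hz : ‖z‖ < 1) : 0 ≤ poissonInt μ z := by
  have hz2 : 0 < 1 - ‖z‖ ^ 2 := by nlinarith [norm_nonneg z]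
  exact mul_nonneg (by positivity) (integral_nonneg fun ζ ↦ by positivity)

lemma exists_lintegral_poissonInt_le {σ τ : ℝ} (hσ : -1 < σ) (hτ : -1 < τ) :
    ∃ C : ENNReal, C ≠ ⊤ ∧ ∀ (μ : Measure ℂ) [IsFiniteMeasure μ],
      μ ((Metric.sphere (0:ℂ) 1)ᶜ) = 0 → ∀ w : ℂ, ‖w‖ < 1 →
      (∫⁻ z in Metric.ball (0:ℂ) 1, ENNReal.ofReal (poissonInt μ z *
        ((1 - ‖z‖ ^ 2) ^ σ / ‖1 - (starRingEnd ℂ) z * w‖ ^ (4 + σ + τ)))) *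
          ENNReal.ofReal ((1 - ‖w‖ ^ 2) ^ (2 + τ)) ≤ C * ENNReal.ofReal (poissonInt μ w) := by
  obtain ⟨C, hC, h⟩ := exists_lintegral_poisson_kernel_le hσ hτ
  refine ⟨C, hC, fun μ _ hμ w hw ↦ ?_⟩
  have e : ∀ z ∈ Metric.ball (0:ℂ) 1, ENNReal.ofReal (poissonInt μ z *
        ((1 - ‖z‖ ^ 2) ^ σ / ‖1 - (starRingEnd ℂ) z * w‖ ^ (4 + σ + τ))) =
      ENNReal.ofReal (2 * Real.pi)⁻¹ * ∫⁻ ζ, ENNReal.ofReal ((1 - ‖z‖ ^ 2) / ‖ζ - z‖ ^ 2 *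
        ((1 - ‖z‖ ^ 2) ^ σ / ‖1 - (starRingEnd ℂ) z * w‖ ^ (4 + σ + τ))) ∂μ := by
    intro z hz
    have hz : ‖z‖ < 1 := by simpa using hz
    have hz2 : 0 < 1 - ‖z‖ ^ 2 := by nlinarith [norm_nonneg z]
    rw [ENNReal.ofReal_mul (poissonInt_nonneg μ hz), ofReal_poissonInt hμ hz, mul_assoc,
      ← lintegral_mul_const' _ _ ENNReal.ofReal_ne_top]
    congr 1
    refine lintegral_congr fun ζ ↦ ?_
    rw [ENNReal.ofReal_mul (by positivity)]
  rw [setLIntegral_congr_fun Metric.isOpen_ball.measurableSet e,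
    lintegral_const_mul' _ _ ENNReal.ofReal_ne_top, lintegral_lintegral_swap
      (Measurable.aemeasurable (by unfold Function.uncurry; fun_prop)), mul_assoc,
    ← lintegral_mul_const' _ _ ENNReal.ofReal_ne_top, ofReal_poissonInt hμ hw, mul_left_comm]
  gcongr
  rw [← lintegral_const_mul' _ _ hC]
  refine lintegral_mono_ae ?_
  filter_upwards [measure_eq_zero_iff_ae_notMem.1 hμ] with ζ hζ
  exact h ζ w (by simpa using hζ) hw

/-- The double integral over `𝔻 × 𝔻`, with the integration over `z` taken last. -/
def doubleIntegral (μ : Measure ℂ) (σ τ : ℝ) (f : ℂ → ℂ) : ENNReal :=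
  ∫⁻ z in Metric.ball (0:ℂ) 1, ENNReal.ofReal (poissonInt μ z * (1 - ‖z‖ ^ 2) ^ σ) *
    ∫⁻ w in Metric.ball (0:ℂ) 1, ENNReal.ofReal (‖f z - f w‖ ^ 2 *
      ((1 - ‖w‖ ^ 2) ^ τ / ‖1 - (starRingEnd ℂ) z * w‖ ^ (4 + σ + τ)))

lemma lintegral_lintegral_eq_doubleIntegral (μ : Measure ℂ) [IsFiniteMeasure μ] (σ τ : ℝ)
    {f : ℂ → ℂ} (hf : ContinuousOn f (Metric.ball (0:ℂ) 1)) :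
    ∫⁻ w in Metric.ball (0:ℂ) 1, ∫⁻ z in Metric.ball (0:ℂ) 1,
        ENNReal.ofReal (‖f z - f w‖ ^ 2 / ‖1 - (starRingEnd ℂ) z * w‖ ^ (4 + σ + τ)
          * (poissonInt μ z * ((1 - ‖z‖ ^ 2) ^ σ * (1 - ‖w‖ ^ 2) ^ τ))) =
      doubleIntegral μ σ τ f := by
  have hB : MeasurableSet (Metric.ball (0:ℂ) 1) := Metric.isOpen_ball.measurableSet
  set F := (Metric.ball (0:ℂ) 1).indicator f with hF
  have hFm : Measurable F := measurable_indicator_of_continuousOn Metric.isOpen_ball hf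
  have hFe : ∀ z ∈ Metric.ball (0:ℂ) 1, f z = F z := fun z hz ↦ (Set.indicator_of_mem hz f).symm
  have hP := measurable_poissonInt μ
  calc _ = ∫⁻ w in Metric.ball (0:ℂ) 1, ∫⁻ z in Metric.ball (0:ℂ) 1,
        ENNReal.ofReal (‖F z - F w‖ ^ 2 / ‖1 - (starRingEnd ℂ) z * w‖ ^ (4 + σ + τ)
          * (poissonInt μ z * ((1 - ‖z‖ ^ 2) ^ σ * (1 - ‖w‖ ^ 2) ^ τ))) :=
        setLIntegral_congr_fun hB fun w hw ↦ setLIntegral_congr_fun hB fun z hz ↦ by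
          rw [hFe z hz, hFe w hw]
    _ = ∫⁻ z in Metric.ball (0:ℂ) 1, ∫⁻ w in Metric.ball (0:ℂ) 1,
        ENNReal.ofReal (‖F z - F w‖ ^ 2 / ‖1 - (starRingEnd ℂ) z * w‖ ^ (4 + σ + τ)
          * (poissonInt μ z * ((1 - ‖z‖ ^ 2) ^ σ * (1 - ‖w‖ ^ 2) ^ τ))) :=
        lintegral_lintegral_swap (Measurable.aemeasurable (by unfold Function.uncurry; fun_prop))
    _ = _ := by
        refine setLIntegral_congr_fun hB fun z hz ↦ ?_
        rw [← lintegral_const_mul' _ _ ENNReal.ofReal_ne_top]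
        refine setLIntegral_congr_fun hB fun w hw ↦ ?_
        have hz1 : ‖z‖ < 1 := by simpa using hz
        have hz2 : 0 < 1 - ‖z‖ ^ 2 := by nlinarith [norm_nonneg z]
        rw [← ENNReal.ofReal_mul (mul_nonneg (poissonInt_nonneg μ hz1) (by positivity)),
          hFe z hz, hFe w hw]
        congr 1
        ring

lemma exists_lintegral_le_doubleIntegral (σ τ : ℝ) :
    ∃ C : ENNReal, C ≠ ⊤ ∧ ∀ (μ : Measure ℂ) (f : ℂ → ℂ),
      DifferentiableOn ℂ f (Metric.ball (0:ℂ) 1) →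
      ∫⁻ z in Metric.ball (0:ℂ) 1, ENNReal.ofReal (‖deriv f z‖ ^ 2 * poissonInt μ z) ≤
        C * doubleIntegral μ σ τ f := by
  obtain ⟨C, hC, h⟩ := exists_ofReal_norm_deriv_sq_le σ τ
  refine ⟨C, hC, fun μ f hf ↦ ?_⟩
  rw [doubleIntegral, ← lintegral_const_mul' _ _ hC]
  refine setLIntegral_mono' Metric.isOpen_ball.measurableSet fun z hz ↦ ?_
  have hz : ‖z‖ < 1 := by simpa using hz
  rw [ENNReal.ofReal_mul (by positivity), ENNReal.ofReal_mul (poissonInt_nonneg μ hz)]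
  grw [h f hf z hz]
  exact le_of_eq (by ring)

lemma exists_doubleIntegral_le {σ τ : ℝ} (hσ : -1 < σ) (hτ : -1 < τ) :
    ∃ C : ENNReal, C ≠ ⊤ ∧ ∀ (μ : Measure ℂ) [IsFiniteMeasure μ],
      μ ((Metric.sphere (0:ℂ) 1)ᶜ) = 0 → ∀ f : ℂ → ℂ,
      DifferentiableOn ℂ f (Metric.ball (0:ℂ) 1) →
      doubleIntegral μ σ τ f ≤
        C * ∫⁻ z in Metric.ball (0:ℂ) 1, ENNReal.ofReal (‖deriv f z‖ ^ 2 * poissonInt μ z) := by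
  obtain ⟨C₁, hC₁, h₁⟩ := exists_lintegral_norm_sub_sq_div_le hσ hτ
  obtain ⟨C₂, hC₂, h₂⟩ := exists_lintegral_poissonInt_le hσ hτ
  refine ⟨C₁ * C₂, by finiteness, fun μ _ hμ f hf ↦ ?_⟩
  have hB : MeasurableSet (Metric.ball (0:ℂ) 1) := Metric.isOpen_ball.measurableSet
  have hP := measurable_poissonInt μ
  have hf' := measurable_deriv f
  have hpos : ∀ z ∈ Metric.ball (0:ℂ) 1, 0 < 1 - ‖z‖ ^ 2 := fun z hz ↦ by
    have hz : ‖z‖ < 1 := by simpa using hz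
    nlinarith [norm_nonneg z]
  calc doubleIntegral μ σ τ f
      ≤ ∫⁻ z in Metric.ball (0:ℂ) 1, C₁ * ∫⁻ w in Metric.ball (0:ℂ) 1,
        ENNReal.ofReal (poissonInt μ z * (1 - ‖z‖ ^ 2) ^ σ) *
          ENNReal.ofReal (‖deriv f w‖ ^ 2 *
            ((1 - ‖w‖ ^ 2) ^ (2 + τ) / ‖1 - (starRingEnd ℂ) z * w‖ ^ (4 + σ + τ))) := by
        refine setLIntegral_mono' hB fun z hz ↦ ?_
        rw [lintegral_const_mul' _ _ ENNReal.ofReal_ne_top, mul_left_comm]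
        gcongr
        exact h₁ f hf z (by simpa using hz)
    _ = C₁ * ∫⁻ w in Metric.ball (0:ℂ) 1, ∫⁻ z in Metric.ball (0:ℂ) 1,
        ENNReal.ofReal (poissonInt μ z * (1 - ‖z‖ ^ 2) ^ σ) *
          ENNReal.ofReal (‖deriv f w‖ ^ 2 *
            ((1 - ‖w‖ ^ 2) ^ (2 + τ) / ‖1 - (starRingEnd ℂ) z * w‖ ^ (4 + σ + τ))) := by
        rw [lintegral_const_mul' _ _ hC₁, lintegral_lintegral_swap
          (Measurable.aemeasurable (by unfold Function.uncurry; fun_prop))]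
    _ = C₁ * ∫⁻ w in Metric.ball (0:ℂ) 1, ENNReal.ofReal (‖deriv f w‖ ^ 2) *
        ((∫⁻ z in Metric.ball (0:ℂ) 1, ENNReal.ofReal (poissonInt μ z *
          ((1 - ‖z‖ ^ 2) ^ σ / ‖1 - (starRingEnd ℂ) z * w‖ ^ (4 + σ + τ)))) *
            ENNReal.ofReal ((1 - ‖w‖ ^ 2) ^ (2 + τ))) := by
        congr 1
        refine setLIntegral_congr_fun hB fun w hw ↦ ?_
        rw [← lintegral_mul_const' _ _ ENNReal.ofReal_ne_top,
          ← lintegral_const_mul' _ _ ENNReal.ofReal_ne_top]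
        refine setLIntegral_congr_fun hB fun z hz ↦ ?_
        have hz2 := hpos z hz
        have hw2 := hpos w hw
        have hP0 := poissonInt_nonneg μ (z := z) (by simpa using hz)
        rw [← ENNReal.ofReal_mul (by positivity), ← ENNReal.ofReal_mul (by positivity),
          ← ENNReal.ofReal_mul (by positivity)]
        congr 1
        ring
    _ ≤ C₁ * ∫⁻ w in Metric.ball (0:ℂ) 1,
        C₂ * ENNReal.ofReal (‖deriv f w‖ ^ 2 * poissonInt μ w) := by
        gcongr C₁ * ?_
        refine setLIntegral_mono' hB fun w hw ↦ ?_
        grw [h₂ μ hμ w (by simpa using hw)]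
        rw [ENNReal.ofReal_mul (by positivity), mul_left_comm]
    _ = _ := by rw [lintegral_const_mul' _ _ hC₂, mul_assoc]

theorem stmt3 (μ : Measure ℂ) [IsFiniteMeasure μ] (hμ : μ ((Metric.sphere (0:ℂ) 1)ᶜ) = 0)
    (σ τ : ℝ) (hσ : -1 < σ) (hτ : -1 < τ)
    (f : ℂ → ℂ) (hf : DifferentiableOn ℂ f (Metric.ball (0:ℂ) 1)) :
    (∫⁻ z in Metric.ball (0:ℂ) 1,
        ENNReal.ofReal (‖deriv f z‖ ^ 2 * poissonInt μ z)) < ⊤ ↔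
    (∫⁻ w in Metric.ball (0:ℂ) 1, ∫⁻ z in Metric.ball (0:ℂ) 1,
        ENNReal.ofReal (‖f z - f w‖ ^ 2 / ‖1 - (starRingEnd ℂ) z * w‖ ^ (4 + σ + τ)
          * (poissonInt μ z * ((1 - ‖z‖ ^ 2) ^ σ * (1 - ‖w‖ ^ 2) ^ τ)))) < ⊤ := by
  rw [lintegral_lintegral_eq_doubleIntegral μ σ τ hf.continuousOn]
  obtain ⟨C₁, hC₁, h₁⟩ := exists_lintegral_le_doubleIntegral σ τ
  obtain ⟨C₂, hC₂, h₂⟩ := exists_doubleIntegral_le hσ hτ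
  exact ⟨fun h ↦ (h₂ μ hμ f hf).trans_lt (ENNReal.mul_lt_top hC₂.lt_top h),
    fun h ↦ (h₁ μ f hf).trans_lt (ENNReal.mul_lt_top hC₁.lt_top h)⟩
end
end
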